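/- arXiv:0808.1616 — 2 statements merged into one kernel-verified Lean document; each statement's English description precedes it below -/
import Mathlib

section
/- There exists a constant C > 0 such that for every real B ≥ 3 one has |N₁(B) − 2·∑_{(a,b)} M̃_{a,b}(B)| ≤ C·B·(log B)³, where the sum is over ordered pairs (a,b) of positive integers with a < √B, b < √B, gcd(a,b) = 1 and ab ≠ 1. -/
open scoped Classical

/-- The counting function `N₁(B)`. -/
noncomputable def None (B : ℝ) : ℕ :=
  Set.ncard {x : ℤ × ℤ × ℤ × ℤ × ℤ |
    0 < x.1 ∧ 0 < x.2.1 ∧ 0 < x.2.2.1 ∧ 0 < x.2.2.2.1 ∧ 0 < x.2.2.2.2 ∧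
    Int.gcd x.1 (Int.gcd x.2.1 (Int.gcd x.2.2.1 x.2.2.2.1)) = 1 ∧
    (x.1 : ℝ) ≤ B ∧ (x.2.1 : ℝ) ≤ B ∧ (x.2.2.1 : ℝ) ≤ B ∧ (x.2.2.2.1 : ℝ) ≤ B ∧
    x.1 * x.2.1 = x.2.2.1 * x.2.2.2.1 ∧
    x.1 ^ 2 + x.2.1 ^ 2 + x.2.2.1 ^ 2 - x.2.2.2.1 ^ 2 - 2 * x.2.2.2.2 ^ 2 = 0 ∧
    ({x.1, x.2.1} : Set ℤ) ≠ ({x.2.2.1, x.2.2.2.1} : Set ℤ)}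

/-- `M̃_{a,b}(B)`: the number of positive integer triples `(x,y,z)` with
`(a²−b²)x² + (a²+b²)y² = 2z²`, `gcd(x,y) = 1`, `max{a,b} < max{x,y}` and
`max{a,b}·max{x,y} ≤ B`. -/
noncomputable def Mtilde (a b : ℤ) (B : ℝ) : ℕ :=
  Set.ncard {p : ℤ × ℤ × ℤ |
    0 < p.1 ∧ 0 < p.2.1 ∧ 0 < p.2.2 ∧
    (a ^ 2 - b ^ 2) * p.1 ^ 2 + (a ^ 2 + b ^ 2) * p.2.1 ^ 2 = 2 * p.2.2 ^ 2 ∧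
    Int.gcd p.1 p.2.1 = 1 ∧
    max a b < max p.1 p.2.1 ∧
    ((max a b : ℤ) : ℝ) * ((max p.1 p.2.1 : ℤ) : ℝ) ≤ B}

section

open Finset

theorem card_le_of_pairwise_dvd (A : Finset ℤ) (K L : ℤ) (hK : 0 < K) (hL : 0 ≤ L)
    (hA : A ⊆ Icc 1 L) (h : ∀ x ∈ A, ∀ y ∈ A, K ∣ 16 * (x - y)) :
    (A.card : ℤ) ≤ 16 * L / K + 1 := by
  rcases A.eq_empty_or_nonempty with rfl | hne
  · simp only [card_empty]; positivity
  set a := A.min' hne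
  have ha : a ∈ A := A.min'_mem hne
  have hcard : A.card ≤ (Icc (0 : ℤ) (16 * L / K)).card := by
    refine card_le_card_of_injOn (fun z => 16 * (z - a) / K) ?_ ?_
    · intro z hz
      have h1 : a ≤ z := A.min'_le z hz
      have h2 := mem_Icc.1 (hA hz)
      have h3 := mem_Icc.1 (hA ha)
      simp only [coe_Icc, Set.mem_Icc]
      exact ⟨Int.ediv_nonneg (by linarith) hK.le, Int.ediv_le_ediv hK (by linarith)⟩
    · intro x hx y hy hxy
      have := Int.ediv_left_inj (h x hx a ha) (h y hy a ha) |>.1 hxy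
      linarith
  have : 0 ≤ 16 * L / K := by positivity
  rw [Int.card_Icc] at hcard
  omega

theorem dvd_sixteen_mul_sub {K e : ℕ} (hK : 0 < K) (he : e ∣ K) {c z₀ z z' : ℤ}
    (hc : IsCoprime c (K : ℤ)) (h₀ : (K : ℤ) ∣ 2 * (z₀ ^ 2 - c))
    (h : (K : ℤ) ∣ 2 * (z ^ 2 - c)) (h' : (K : ℤ) ∣ 2 * (z' ^ 2 - c))
    (hz : Int.gcd K (z - z₀) = e) (hz' : Int.gcd K (z' - z₀) = e) :
    (K : ℤ) ∣ 16 * (z - z') := by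
  obtain ⟨f, hf⟩ := he
  have he0 : 0 < e := Nat.pos_of_mul_pos_right (by rw [← hf]; exact hK) 
  have key : ∀ w : ℤ, (K : ℤ) ∣ 2 * (w ^ 2 - c) → Int.gcd K (w - z₀) = e →
      (e : ℤ) ∣ w - z₀ ∧ (f : ℤ) ∣ 2 * (w + z₀) := by
    intro w hw hwe
    have h1 : (e : ℤ) ∣ w - z₀ := hwe ▸ Int.gcd_dvd_right _ _
    refine ⟨h1, ?_⟩
    have h2 : (K : ℤ) ∣ (w - z₀) * (2 * (w + z₀)) := by
      refine (dvd_sub hw h₀).trans (dvd_of_eq ?_); ring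
    obtain ⟨k, hk⟩ := h1
    have hcop : IsCoprime (f : ℤ) k := by
      rw [Int.isCoprime_iff_gcd_eq_one]
      have : e * Int.gcd f k = e := by
        conv_rhs => rw [← hwe, hk, hf]
        push_cast
        rw [Int.gcd_mul_left]; simp
      exact Nat.eq_of_mul_eq_mul_left he0 (by simpa using this)
    have h3 : (f : ℤ) ∣ k * (2 * (w + z₀)) := by
      rw [hk, hf] at h2
      push_cast at h2
      rw [mul_assoc] at h2
      exact (mul_dvd_mul_iff_left (by exact_mod_cast he0.ne')).1 h2
    exact hcop.dvd_of_dvd_mul_left h3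
  obtain ⟨a1, b1⟩ := key z h hz
  obtain ⟨a2, b2⟩ := key z' h' hz'
  have hg8 : (Int.gcd e f : ℤ) ∣ 8 := by
    set g := (Int.gcd e f : ℤ)
    have g1 : g ∣ (e : ℤ) := Int.gcd_dvd_left _ _
    have g2 : g ∣ (f : ℤ) := Int.gcd_dvd_right _ _
    have g3 : g ∣ 4 * z₀ := by
      refine (dvd_sub (g2.trans b1) ((g1.trans a1).mul_left 2)).trans (dvd_of_eq ?_); ring
    have gK : g ∣ (K : ℤ) := g1.trans ⟨f, by exact_mod_cast hf⟩
    obtain ⟨x, y, hxy⟩ := hc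
    have g4 : g ∣ 8 * c := by
      refine (dvd_sub (g3.mul_left (2 * z₀)) ((gK.trans h₀).mul_left 4)).trans (dvd_of_eq ?_); ring
    refine (dvd_add (g4.mul_left x) (gK.mul_left (8 * y))).trans (dvd_of_eq ?_)
    linear_combination 8 * hxy
  have e1 : (e : ℤ) ∣ 2 * (z - z') := by
    refine ((dvd_sub a1 a2).mul_left 2).trans (dvd_of_eq ?_); ring
  have f1 : (f : ℤ) ∣ 2 * (z - z') := by
    refine (dvd_sub b1 b2).trans (dvd_of_eq ?_); ring
  have hl : (Int.lcm e f : ℤ) ∣ 2 * (z - z') := Int.coe_lcm_dvd e1 f1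
  have : (K : ℤ) = (Int.gcd e f : ℤ) * (Int.lcm e f : ℤ) := by
    rw [hf]; exact_mod_cast (Int.gcd_mul_lcm e f).symm
  rw [this]
  refine (mul_dvd_mul hg8 hl).trans (dvd_of_eq ?_); ring

theorem card_roots_le {K : ℕ} (hK : 0 < K) {c : ℤ} (hc : IsCoprime c (K : ℤ)) (L : ℕ) :
    (((Icc (1 : ℤ) L).filter (fun z => (K : ℤ) ∣ 2 * (z ^ 2 - c))).card : ℝ) ≤
      K.divisors.card * (16 * L / K + 1) := by
  set A := (Icc (1 : ℤ) L).filter (fun z => (K : ℤ) ∣ 2 * (z ^ 2 - c))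
  have hK' : (0 : ℝ) < K := by exact_mod_cast hK
  rcases A.eq_empty_or_nonempty with h0 | ⟨z₀, hz₀⟩
  · rw [h0]; simp only [card_empty, Nat.cast_zero]; positivity
  have hA : ∀ z ∈ A, z ∈ Icc (1 : ℤ) L ∧ (K : ℤ) ∣ 2 * (z ^ 2 - c) := fun z hz => mem_filter.1 hz
  have hmaps : ∀ z ∈ A, Int.gcd K (z - z₀) ∈ K.divisors := fun z _ =>
    Nat.mem_divisors.2 ⟨by exact_mod_cast Int.gcd_dvd_left (K : ℤ) (z - z₀), hK.ne'⟩
  rw [card_eq_sum_card_fiberwise hmaps]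
  push_cast
  rw [← nsmul_eq_mul]
  refine sum_le_card_nsmul _ _ _ fun e he => ?_
  have h1 := card_le_of_pairwise_dvd (A.filter (fun z => Int.gcd K (z - z₀) = e)) K L
    (by exact_mod_cast hK) (by positivity)
    (fun z hz => (hA z (mem_filter.1 hz).1).1)
    (fun x hx y hy => dvd_sixteen_mul_sub hK (Nat.dvd_of_mem_divisors he) hc (hA z₀ hz₀).2
      (hA x (mem_filter.1 hx).1).2 (hA y (mem_filter.1 hy).1).2 (mem_filter.1 hx).2
      (mem_filter.1 hy).2)
  have h2 : ((16 * L / K : ℕ) : ℝ) ≤ 16 * L / K := by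
    have := @Nat.cast_div_le ℝ _ _ _ (16 * L) K
    simpa using this
  have h3 : ((#{z ∈ A | Int.gcd K (z - z₀) = e} : ℕ)) ≤ 16 * L / K + 1 := by
    exact_mod_cast h1
  calc ((#{z ∈ A | Int.gcd K (z - z₀) = e} : ℕ) : ℝ) ≤ ((16 * L / K + 1 : ℕ) : ℝ) := by
        exact_mod_cast h3
    _ ≤ _ := by push_cast at h2 ⊢; linarith

theorem sum_card_divisors_mul_le (X : ℕ) (f : ℕ → ℝ) :
    ∑ d ∈ Icc 1 X, (d.divisors.card : ℝ) * f d =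
      ∑ e ∈ Icc 1 X, ∑ k ∈ Icc 1 (X / e), f (e * k) := by
  have h1 : ∀ d ∈ Icc 1 X, (d.divisors.card : ℝ) * f d =
      ∑ e ∈ Icc 1 X, if e ∣ d then f d else 0 := by
    intro d hd
    have hd := mem_Icc.1 hd
    rw [← sum_filter, sum_const, nsmul_eq_mul]
    congr 3
    ext e
    simp only [Nat.mem_divisors, mem_filter, mem_Icc]
    constructor
    · rintro ⟨h, h0⟩
      exact ⟨⟨Nat.pos_of_dvd_of_pos h (by omega), (Nat.le_of_dvd (by omega) h).trans hd.2⟩, h⟩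
    · rintro ⟨-, h⟩
      exact ⟨h, by omega⟩
  rw [sum_congr rfl h1, sum_comm]
  refine sum_congr rfl fun e he => ?_
  have he := mem_Icc.1 he
  rw [← sum_filter]
  symm
  refine sum_nbij (fun k => e * k) ?_ ?_ ?_ (fun _ _ => rfl)
  · intro k hk
    simp only [mem_Icc, mem_filter] at hk ⊢
    exact ⟨⟨Nat.mul_pos he.1 hk.1, (Nat.mul_le_mul_left e hk.2).trans (Nat.mul_div_le X e)⟩,
      dvd_mul_right _ _⟩
  · intro x _ y _ h
    exact Nat.eq_of_mul_eq_mul_left he.1 h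
  · intro d hd
    simp only [coe_filter, mem_Icc, Set.mem_ofPred_eq] at hd
    obtain ⟨⟨h0, hX⟩, k, rfl⟩ := hd
    refine ⟨k, ?_, rfl⟩
    simp only [coe_Icc, Set.mem_Icc]
    exact ⟨Nat.pos_of_mul_pos_left h0, (Nat.le_div_iff_mul_le he.1).2 (by rwa [mul_comm])⟩

theorem sum_inv_le_one_add_log (X : ℕ) : ∑ d ∈ Icc 1 X, (d : ℝ)⁻¹ ≤ 1 + Real.log X := by
  have := harmonic_le_one_add_log X
  rw [harmonic_eq_sum_Icc] at this
  push_cast at this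
  exact this

theorem sum_card_divisors_div_le (X : ℕ) :
    ∑ d ∈ Icc 1 X, (d.divisors.card : ℝ) / d ≤ (1 + Real.log X) ^ 2 := by
  simp_rw [div_eq_mul_inv]
  rw [sum_card_divisors_mul_le X (fun d => (d : ℝ)⁻¹)]
  calc ∑ e ∈ Icc 1 X, ∑ k ∈ Icc 1 (X / e), (((e * k : ℕ) : ℝ))⁻¹
      ≤ ∑ e ∈ Icc 1 X, ∑ k ∈ Icc 1 X, (e : ℝ)⁻¹ * (k : ℝ)⁻¹ := by
        refine sum_le_sum fun e _ => ?_
        push_cast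
        simp_rw [mul_inv]
        exact sum_le_sum_of_subset_of_nonneg (Icc_subset_Icc_right (Nat.div_le_self _ _))
          fun _ _ _ => by positivity
    _ = (∑ e ∈ Icc 1 X, (e : ℝ)⁻¹) ^ 2 := by rw [sq, sum_mul_sum]
    _ ≤ _ := by
        gcongr
        exact sum_inv_le_one_add_log X

theorem sum_card_divisors_le (X : ℕ) :
    ∑ d ∈ Icc 1 X, (d.divisors.card : ℝ) ≤ X * (1 + Real.log X) := by
  have := sum_card_divisors_mul_le X (fun _ => 1)
  simp only [mul_one] at this
  rw [this]
  calc ∑ e ∈ Icc 1 X, ∑ k ∈ Icc 1 (X / e), (1 : ℝ)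
      ≤ ∑ e ∈ Icc 1 X, X * (e : ℝ)⁻¹ := by
        refine sum_le_sum fun e _ => ?_
        simp only [sum_const, Nat.card_Icc, add_tsub_cancel_right, nsmul_eq_mul, mul_one]
        rw [← div_eq_mul_inv]
        exact Nat.cast_div_le
    _ ≤ _ := by
        rw [← mul_sum]
        gcongr
        exact sum_inv_le_one_add_log X

theorem card_divisors_le_two_mul {n Y : ℕ} (h : n < (Y + 1) ^ 2) :
    n.divisors.card ≤ 2 * ((Icc 1 Y).filter (· ∣ n)).card := by
  have hsub : n.divisors ⊆
      (Icc 1 Y).filter (· ∣ n) ∪ ((Icc 1 Y).filter (· ∣ n)).image (fun d => n / d) := by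
    intro d hd
    obtain ⟨⟨e, rfl⟩, h0⟩ := Nat.mem_divisors.1 hd
    have hd0 : 0 < d := Nat.pos_of_ne_zero (by rintro rfl; simp at h0)
    have he0 : 0 < e := Nat.pos_of_ne_zero (by rintro rfl; simp at h0)
    simp only [mem_union, mem_filter, mem_Icc, mem_image]
    by_cases hdY : d ≤ Y
    · exact Or.inl ⟨⟨hd0, hdY⟩, dvd_mul_right _ _⟩
    · refine Or.inr ⟨e, ⟨⟨he0, ?_⟩, dvd_mul_left _ _⟩, Nat.mul_div_cancel _ he0⟩
      by_contra hc
      nlinarith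
  refine (card_le_card hsub).trans ((Finset.card_union_le _ _).trans ?_)
  rw [two_mul]
  exact Nat.add_le_add_left card_image_le _

theorem card_divisors_mul_le (a b : ℕ) :
    (a * b).divisors.card ≤ a.divisors.card * b.divisors.card := by
  rw [Nat.divisors_mul]
  exact card_mul_le

/-- The average of `τ(m² + p²)` over coprime `m, p ≤ H`. -/
theorem sum_card_divisors_sq_add_sq_le {H : ℕ} :
    ∑ m ∈ Icc 1 H, ∑ p ∈ (Icc 1 H).filter (Nat.Coprime m), ((m ^ 2 + p ^ 2).divisors.card : ℝ) ≤
      36 * (H : ℝ) ^ 2 * (1 + Real.log (2 * H)) ^ 2 := by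
  have hm : ∀ m ∈ Icc 1 H, ∑ p ∈ (Icc 1 H).filter (Nat.Coprime m),
      ((m ^ 2 + p ^ 2).divisors.card : ℝ) ≤ 36 * H * (1 + Real.log (2 * H)) ^ 2 := by
    intro m hm
    have hm := mem_Icc.1 hm
    set P := (Icc 1 H).filter (Nat.Coprime m)
    calc ∑ p ∈ P, ((m ^ 2 + p ^ 2).divisors.card : ℝ)
        ≤ ∑ p ∈ P, 2 * ∑ d ∈ Icc 1 (2 * H), if d ∣ m ^ 2 + p ^ 2 then (1 : ℝ) else 0 := by
          refine sum_le_sum fun p hp => ?_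
          have hp := mem_Icc.1 (mem_filter.1 hp).1
          have h := @card_divisors_le_two_mul (m ^ 2 + p ^ 2) (2 * H) (by nlinarith)
          rw [← sum_filter, sum_const, nsmul_eq_mul, mul_one]
          exact_mod_cast h
      _ = 2 * ∑ d ∈ Icc 1 (2 * H), ((P.filter (fun p => d ∣ m ^ 2 + p ^ 2)).card : ℝ) := by
          rw [← mul_sum, sum_comm]
          congr 1
          refine sum_congr rfl fun d _ => ?_
          rw [← sum_filter, sum_const, nsmul_eq_mul, mul_one]
      _ ≤ 2 * ∑ d ∈ Icc 1 (2 * H), 18 * H * ((d.divisors.card : ℝ) / d) := by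
          gcongr with d hd
          have hd := mem_Icc.1 hd
          have hd0 : (0 : ℝ) < d := by exact_mod_cast hd.1
          rcases (P.filter (fun p => d ∣ m ^ 2 + p ^ 2)).eq_empty_or_nonempty with h0 | ⟨p₀, hp₀⟩
          · rw [h0]; simp only [card_empty, Nat.cast_zero]; positivity
          have hcop : Nat.Coprime m d := by
            obtain ⟨hp1, hp2⟩ := mem_filter.1 hp₀
            have hmp : Nat.Coprime m p₀ := (mem_filter.1 hp1).2
            have : Nat.Coprime m (m ^ 2 + p₀ ^ 2) := by
              rw [sq m, Nat.coprime_mul_right_add_right]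
              exact hmp.pow_right 2
            exact this.coprime_dvd_right hp2
          have hc : IsCoprime (-(m : ℤ) ^ 2) (d : ℤ) :=
            (Nat.isCoprime_iff_coprime.2 hcop).pow_left.neg_left
          refine le_trans ?_ ((card_roots_le hd.1 hc H).trans ?_)
          · norm_cast
            refine card_le_card_of_injOn (fun p : ℕ => (p : ℤ)) ?_ (fun _ _ _ _ h => by simpa using h)
            intro p hp
            obtain ⟨hp1, hp2⟩ := mem_filter.1 hp
            have hp3 := mem_Icc.1 (mem_filter.1 hp1).1
            simp only [coe_filter, mem_Icc, Set.mem_ofPred_eq]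
            refine ⟨⟨by exact_mod_cast hp3.1, by exact_mod_cast hp3.2⟩, Dvd.dvd.mul_left ?_ 2⟩
            have : (d : ℤ) ∣ (m : ℤ) ^ 2 + (p : ℤ) ^ 2 := by exact_mod_cast hp2
            exact this.trans (dvd_of_eq (by push_cast; ring))
          · have : (d : ℝ) ≤ 2 * H := by exact_mod_cast hd.2
            calc (d.divisors.card : ℝ) * (16 * H / d + 1)
                ≤ d.divisors.card * (16 * H / d + 2 * H / d) := by
                  gcongr; rwa [le_div_iff₀ hd0, one_mul]
              _ = _ := by ring
      _ ≤ 2 * (18 * H * (1 + Real.log (2 * H)) ^ 2) := by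
          rw [← mul_sum]
          gcongr
          exact_mod_cast sum_card_divisors_div_le (2 * H)
      _ = _ := by ring
  refine (sum_le_sum hm).trans (le_of_eq ?_)
  rw [sum_const, nsmul_eq_mul, Nat.card_Icc, add_tsub_cancel_right]
  ring

/-- The average of `τ(m² - p²) m² / (m² - p²)` over `p < m ≤ H`. -/
theorem sum_card_divisors_sq_sub_sq_le {H : ℕ} :
    ∑ m ∈ Icc 1 H, ∑ p ∈ (Icc 1 H).filter (· < m),
      ((m ^ 2 - p ^ 2).divisors.card : ℝ) * (32 * m ^ 2 / ((m ^ 2 - p ^ 2 : ℕ) : ℝ) + 1) ≤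
      132 * (H : ℝ) ^ 2 * (1 + Real.log (2 * H)) ^ 3 := by
  rw [sum_sigma']
  set F : ℕ × ℕ → ℝ := fun q =>
    33 * (((q.1.divisors.card : ℝ) / q.1) * ((q.2.divisors.card : ℝ) * q.2))
  calc _ ≤ ∑ x ∈ (Icc 1 H).sigma (fun m => (Icc 1 H).filter (· < m)), F (x.1 - x.2, x.1 + x.2) := by
        refine sum_le_sum ?_
        rintro ⟨m, p⟩ hx
        simp only [mem_sigma, mem_filter, mem_Icc] at hx
        obtain ⟨hm, hp, hpm⟩ := hx
        simp only [F]
        have hK : m ^ 2 - p ^ 2 = (m - p) * (m + p) := by rw [Nat.sq_sub_sq, mul_comm]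
        rw [hK]
        have ha0 : (0 : ℝ) < (m - p : ℕ) := by exact_mod_cast Nat.sub_pos_of_lt hpm
        have hb0 : (0 : ℝ) < (m + p : ℕ) := by exact_mod_cast (by omega : 0 < m + p)
        have hab : ((m - p : ℕ) : ℝ) ≤ (m + p : ℕ) := by exact_mod_cast (by omega : m - p ≤ m + p)
        have hmb : (m : ℝ) ≤ (m + p : ℕ) := by exact_mod_cast (by omega : m ≤ m + p)
        have hτ : (((m - p) * (m + p)).divisors.card : ℝ) ≤
          (m - p).divisors.card * (m + p).divisors.card := by
            exact_mod_cast card_divisors_mul_le _ _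
        set a : ℝ := ((m - p : ℕ) : ℝ)
        set b : ℝ := ((m + p : ℕ) : ℝ)
        have hfac : 32 * (m : ℝ) ^ 2 / (((m - p) * (m + p) : ℕ) : ℝ) + 1 ≤ 33 * (b / a) := by
          rw [Nat.cast_mul]
          calc 32 * (m : ℝ) ^ 2 / (a * b) + 1 ≤ 32 * b ^ 2 / (a * b) + b / a := by
                gcongr; rwa [le_div_iff₀ ha0, one_mul]
            _ = _ := by field_simp; ring
        calc _ ≤ ((m - p).divisors.card * (m + p).divisors.card : ℝ) * (33 * (b / a)) := by
              gcongr
          _ = _ := by ring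
    _ ≤ ∑ q ∈ Icc 1 (2 * H) ×ˢ Icc 1 (2 * H), F q := by
        rw [← sum_image (f := F) (g := fun x : (_ : ℕ) × ℕ => (x.1 - x.2, x.1 + x.2))]
        · refine sum_le_sum_of_subset_of_nonneg ?_ (fun q _ _ => by positivity)
          intro q hq
          simp only [mem_image, mem_sigma, mem_filter, mem_Icc, mem_product] at hq ⊢
          obtain ⟨x, hx, rfl⟩ := hq
          dsimp only
          omega
        · rintro ⟨m, p⟩ hx ⟨m', p'⟩ hx' h
          simp only [coe_sigma, Set.mem_sigma_iff, coe_filter, coe_Icc, Set.mem_Icc, mem_Icc,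
            Set.mem_ofPred_eq] at hx hx'
          simp only [Prod.mk.injEq] at h
          obtain ⟨rfl, rfl⟩ : m = m' ∧ p = p' := by omega
          rfl
    _ = 33 * ((∑ a ∈ Icc 1 (2 * H), (a.divisors.card : ℝ) / a) *
          ∑ b ∈ Icc 1 (2 * H), (b.divisors.card : ℝ) * b) := by
        simp only [F]
        rw [← mul_sum, sum_mul_sum, sum_product]
    _ ≤ 33 * ((1 + Real.log (2 * H)) ^ 2 * ((2 * H) * (1 + Real.log (2 * H)) * (2 * H))) := by
        gcongr
        · exact_mod_cast sum_card_divisors_div_le (2 * H)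
        · calc ∑ b ∈ Icc 1 (2 * H), (b.divisors.card : ℝ) * b
              ≤ ∑ b ∈ Icc 1 (2 * H), (b.divisors.card : ℝ) * (2 * H) := by
                gcongr with b hb
                exact_mod_cast (mem_Icc.1 hb).2
            _ ≤ _ := by
                rw [← sum_mul]
                gcongr
                exact_mod_cast sum_card_divisors_le (2 * H)
    _ = _ := by ring

/-- Parametrization of the points counted by `None`: `x₀ = su`, `x₁ = tv`, `x₂ = sv`, `x₃ = tu`,
with entries `(s, t, u, v, z)`. -/
def paramSet (B : ℝ) : Set (ℤ × ℤ × ℤ × ℤ × ℤ) :=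
  {q | (0 < q.1 ∧ 0 < q.2.1 ∧ 0 < q.2.2.1 ∧ 0 < q.2.2.2.1 ∧ 0 < q.2.2.2.2) ∧
    Int.gcd q.1 q.2.1 = 1 ∧ Int.gcd q.2.2.1 q.2.2.2.1 = 1 ∧
    q.1 ≠ q.2.1 ∧ q.2.2.1 ≠ q.2.2.2.1 ∧
    (q.1 ^ 2 - q.2.1 ^ 2) * q.2.2.1 ^ 2 + (q.1 ^ 2 + q.2.1 ^ 2) * q.2.2.2.1 ^ 2 =
      2 * q.2.2.2.2 ^ 2 ∧
    ((max q.1 q.2.1 : ℤ) : ℝ) * ((max q.2.2.1 q.2.2.2.1 : ℤ) : ℝ) ≤ B}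

theorem gcd_mul_eq_one {s t u v : ℤ} (h : Int.gcd s t = 1) (h' : Int.gcd u v = 1) :
    Int.gcd (s * u) (Int.gcd (t * v) (Int.gcd (s * v) (t * u))) = 1 := by
  rw [← Int.isCoprime_iff_gcd_eq_one] at h h'
  obtain ⟨a, b, hab⟩ := h
  obtain ⟨c, d, hcd⟩ := h'
  set g := Int.gcd (s * u) (Int.gcd (t * v) (Int.gcd (s * v) (t * u)))
  have h1 : (g : ℤ) ∣ s * u := Int.gcd_dvd_left _ _
  have h2 : (g : ℤ) ∣ (Int.gcd (t * v) (Int.gcd (s * v) (t * u)) : ℤ) := Int.gcd_dvd_right _ _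
  have h3 : (g : ℤ) ∣ t * v := h2.trans (Int.gcd_dvd_left _ _)
  have h4 : (g : ℤ) ∣ (Int.gcd (s * v) (t * u) : ℤ) := h2.trans (Int.gcd_dvd_right _ _)
  have h5 : (g : ℤ) ∣ s * v := h4.trans (Int.gcd_dvd_left _ _)
  have h6 : (g : ℤ) ∣ t * u := h4.trans (Int.gcd_dvd_right _ _)
  have : (g : ℤ) ∣ 1 := by
    refine (dvd_add (dvd_add (h1.mul_left (a * c)) (h3.mul_left (b * d)))
      (dvd_add (h5.mul_left (a * d)) (h6.mul_left (b * c)))).trans (dvd_of_eq ?_)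
    linear_combination (c * u + d * v) * hab + hcd
  exact Nat.eq_one_of_dvd_one (by exact_mod_cast this)

theorem pair_eq_iff {s t u v : ℤ} (hs : 0 < s) (hu : 0 < u) (hv : 0 < v) :
    ({s * u, t * v} : Set ℤ) = {s * v, t * u} ↔ s = t ∨ u = v := by
  rw [Set.pair_eq_pair_iff]
  constructor
  · rintro (⟨h, -⟩ | ⟨h, -⟩)
    · exact Or.inr (mul_left_cancel₀ hs.ne' h)
    · exact Or.inl (mul_right_cancel₀ hu.ne' h)
  · rintro (rfl | rfl)
    · exact Or.inr ⟨rfl, rfl⟩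
    · exact Or.inl ⟨rfl, rfl⟩

theorem max_mul_max_le_iff {s t u v : ℤ} {B : ℝ} (hs : 0 < s) (hu : 0 < u) (hv : 0 < v) :
    ((max s t : ℤ) : ℝ) * ((max u v : ℤ) : ℝ) ≤ B ↔
      ((s * u : ℤ) : ℝ) ≤ B ∧ ((t * v : ℤ) : ℝ) ≤ B ∧ ((s * v : ℤ) : ℝ) ≤ B ∧
        ((t * u : ℤ) : ℝ) ≤ B := by
  rw [← Int.cast_mul]
  simp only [← Int.le_floor]
  constructor
  · intro h
    have h1 := le_max_left s t
    have h2 := le_max_right s t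
    have h3 := le_max_left u v
    have h4 := le_max_right u v
    refine ⟨?_, ?_, ?_, ?_⟩ <;> refine le_trans ?_ h <;> gcongr
  · rintro ⟨h1, h2, h3, h4⟩
    rcases max_choice s t with h | h <;> rcases max_choice u v with h' | h' <;> rw [h, h'] <;>
      assumption

theorem None_eq_ncard_paramSet (B : ℝ) : None B = (paramSet B).ncard := by
  symm
  refine Set.ncard_congr (fun q _ => (q.1 * q.2.2.1, q.2.1 * q.2.2.2.1, q.1 * q.2.2.2.1,
    q.2.1 * q.2.2.1, q.2.2.2.2)) ?_ ?_ ?_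
  · rintro ⟨s, t, u, v, z⟩ ⟨⟨hs, ht, hu, hv, hz⟩, hst, huv, hne, hne', heq, hB⟩
    dsimp only at hs ht hu hv hz hst huv hne hne' heq hB
    obtain ⟨h1, h2, h3, h4⟩ := (max_mul_max_le_iff hs hu hv).1 hB
    refine ⟨mul_pos hs hu, mul_pos ht hv, mul_pos hs hv, mul_pos ht hu, hz,
      gcd_mul_eq_one hst huv, h1, h2, h3, h4, ?_, ?_, ?_⟩
    · dsimp only; ring
    · dsimp only; linear_combination heq
    · exact fun h => ((pair_eq_iff hs hu hv).1 h).elim hne hne'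
  · rintro ⟨s, t, u, v, z⟩ ⟨s', t', u', v', z'⟩ ⟨⟨hs, ht, hu, hv, hz⟩, hst, huv, -⟩
      ⟨⟨hs', ht', hu', hv', hz'⟩, hst', huv', -⟩ h
    dsimp only at hs ht hu hv hz hst huv hs' ht' hu' hv' hz' hst' huv'
    simp only [Prod.mk.injEq] at h
    obtain ⟨h0, h1, h2, h3, rfl⟩ := h
    have e1 : s = s' := by
      have : Int.gcd (s * u) (s * v) = Int.gcd (s' * u') (s' * v') := by rw [h0, h2]
      rw [Int.gcd_mul_left, Int.gcd_mul_left, huv, huv'] at this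
      omega
    subst e1
    have e2 := mul_left_cancel₀ hs.ne' h0
    have e3 := mul_left_cancel₀ hs.ne' h2
    subst e2 e3
    have e4 := mul_right_cancel₀ hu.ne' h3
    subst e4
    rfl
  · rintro ⟨x, y, w, r, z⟩ ⟨hx, hy, hw, hr, hz, hg, h1, h2, h3, h4, hxy, heq, hne⟩
    dsimp only at hx hy hw hr hz hg h1 h2 h3 h4 hxy heq hne
    obtain ⟨s, u, v, hs0, huv, rfl, rfl⟩ :
        ∃ s u v : ℤ, 0 < s ∧ Int.gcd u v = 1 ∧ x = s * u ∧ w = s * v := by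
      have h0 := Int.gcd_pos_of_ne_zero_left w hx.ne'
      obtain ⟨u, v, huv, hu, hv⟩ := Int.exists_gcd_one h0
      exact ⟨Int.gcd x w, u, v, by exact_mod_cast h0, huv, by rw [mul_comm]; exact hu,
        by rw [mul_comm]; exact hv⟩
    have hu : 0 < u := pos_of_mul_pos_right hx hs0.le
    have hv : 0 < v := pos_of_mul_pos_right hw hs0.le
    have huy : u * y = v * r := by
      apply mul_left_cancel₀ hs0.ne'
      linear_combination hxy
    have hvy : v ∣ y := (Int.isCoprime_iff_gcd_eq_one.2 huv).symm.dvd_of_dvd_mul_left ⟨r, huy⟩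
    obtain ⟨t, rfl⟩ := hvy
    have hr' : r = t * u := by
      apply mul_left_cancel₀ hv.ne'
      linear_combination -huy
    subst hr'
    have ht : 0 < t := pos_of_mul_pos_right hy hv.le
    rw [mul_comm v t] at *
    refine ⟨(s, t, u, v, z), ⟨⟨hs0, ht, hu, hv, hz⟩, ?_, huv, ?_, ?_, ?_, ?_⟩, rfl⟩
    · have a1 : (Int.gcd s t : ℤ) ∣ s := Int.gcd_dvd_left _ _
      have a2 : (Int.gcd s t : ℤ) ∣ t := Int.gcd_dvd_right _ _
      have := Int.dvd_coe_gcd (a1.mul_right u) (Int.dvd_coe_gcd (a2.mul_right v)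
        (Int.dvd_coe_gcd (a1.mul_right v) (a2.mul_right u)))
      rw [hg] at this
      exact Nat.eq_one_of_dvd_one (by exact_mod_cast this)
    · exact fun h => hne ((pair_eq_iff hs0 hu hv).2 (Or.inl h))
    · exact fun h => hne ((pair_eq_iff hs0 hu hv).2 (Or.inr h))
    · dsimp only; linear_combination heq
    · exact (max_mul_max_le_iff hs0 hu hv).2 ⟨h1, h2, h3, h4⟩

theorem paramSet_z_le {q : ℤ × ℤ × ℤ × ℤ × ℤ} {B : ℝ} (hq : q ∈ paramSet B) :
    q.2.2.2.2 ≤ 2 * (max q.1 q.2.1 * max q.2.2.1 q.2.2.2.1) := by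
  obtain ⟨s, t, u, v, z⟩ := q
  obtain ⟨⟨hs, ht, hu, hv, hz⟩, -, -, -, -, heq, -⟩ := hq
  dsimp only at *
  have h1 : (s * u) ^ 2 ≤ (max s t * max u v) ^ 2 := by
    gcongr <;> exact le_max_left _ _
  have h2 : (s * v) ^ 2 ≤ (max s t * max u v) ^ 2 := by
    gcongr <;> first | exact le_max_left _ _ | exact le_max_right _ _
  have h3 : (t * v) ^ 2 ≤ (max s t * max u v) ^ 2 := by
    gcongr <;> exact le_max_right _ _
  have h4 : 0 ≤ max s t * max u v := mul_nonneg (hs.le.trans (le_max_left _ _))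
    (hu.le.trans (le_max_left _ _))
  refine abs_le_of_sq_le_sq' (a := z) ?_ (by linarith) |>.2
  nlinarith [sq_nonneg (t * u)]

theorem finite_paramSet (B : ℝ) : (paramSet B).Finite := by
  refine (((Set.finite_Icc (1 : ℤ) ⌊B⌋).prod ((Set.finite_Icc (1 : ℤ) ⌊B⌋).prod
    ((Set.finite_Icc (1 : ℤ) ⌊B⌋).prod ((Set.finite_Icc (1 : ℤ) ⌊B⌋).prod
      (Set.finite_Icc (1 : ℤ) (2 * ⌊B⌋))))))).subset ?_
  intro q hq
  have hzle := paramSet_z_le hq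
  obtain ⟨s, t, u, v, z⟩ := q
  obtain ⟨⟨hs, ht, hu, hv, hz⟩, -, -, -, -, -, hB⟩ := hq
  dsimp only at *
  have hB' : max s t * max u v ≤ ⌊B⌋ := by rw [Int.le_floor]; exact_mod_cast hB
  obtain ⟨h1, h2, h3, h4⟩ := (max_mul_max_le_iff hs hu hv).1 hB
  rw [← Int.le_floor] at h1 h2 h3 h4
  simp only [Set.mem_prod, Set.mem_Icc]
  refine ⟨⟨hs, ?_⟩, ⟨ht, ?_⟩, ⟨hu, ?_⟩, ⟨hv, ?_⟩, hz, ?_⟩ <;> nlinarith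

theorem ncard_paramSet_lt_eq_sum (B : ℝ) :
    {q ∈ paramSet B | max q.1 q.2.1 < max q.2.2.1 q.2.2.2.1}.ncard =
      ∑ q ∈ (Finset.Icc (1 : ℤ) ⌊Real.sqrt B⌋ ×ˢ Finset.Icc (1 : ℤ) ⌊Real.sqrt B⌋).filter
        (fun q => (q.1 : ℝ) < Real.sqrt B ∧ (q.2 : ℝ) < Real.sqrt B ∧
          Int.gcd q.1 q.2 = 1 ∧ q.1 * q.2 ≠ 1), Mtilde q.1 q.2 B := by
  have hfin : {q ∈ paramSet B | max q.1 q.2.1 < max q.2.2.1 q.2.2.2.1}.Finite :=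
    (finite_paramSet B).subset (Set.sep_subset _ _)
  rw [Set.ncard_eq_toFinset_card _ hfin, card_eq_sum_card_fiberwise (f := fun q => (q.1, q.2.1))]
  · refine sum_congr rfl fun ⟨a, b⟩ hab => ?_
    simp only [mem_filter, mem_product, mem_Icc] at hab
    obtain ⟨⟨⟨ha, -⟩, hb, -⟩, -, -, hgcd, hne⟩ := hab
    rw [Mtilde, ← Set.ncard_image_of_injective _
      (f := fun p : ℤ × ℤ × ℤ => (a, b, p.1, p.2.1, p.2.2)) (fun x y h => by
        simp only [Prod.mk.injEq, true_and] at h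
        exact Prod.ext h.1 (Prod.ext h.2.1 h.2.2)), ← Set.ncard_coe_finset]
    congr 1
    ext ⟨s, t, u, v, z⟩
    simp only [coe_filter, Set.Finite.mem_toFinset, Set.mem_ofPred_eq, Set.mem_image, paramSet,
      Prod.mk.injEq, Prod.exists]
    constructor
    · rintro ⟨⟨⟨⟨hs, ht, hu, hv, hz⟩, hst, huv, h1, h2, heq, hB⟩, hlt⟩, rfl, rfl⟩
      exact ⟨u, v, z, ⟨hu, hv, hz, heq, huv, hlt, hB⟩, rfl, rfl, rfl, rfl, rfl⟩
    · rintro ⟨u, v, z, ⟨hu, hv, hz, heq, huv, hlt, hB⟩, rfl, rfl, rfl, rfl, rfl⟩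
      refine ⟨⟨⟨⟨ha, hb, hu, hv, hz⟩, hgcd, huv, ?_, ?_, heq, hB⟩, hlt⟩, rfl, rfl⟩
      · rintro rfl
        rw [Int.gcd_self] at hgcd
        exact hne (by rw [show a = 1 by omega]; rfl)
      · rintro rfl
        rw [Int.gcd_self] at huv
        rw [max_self] at hlt
        have := le_max_left a b
        omega
  · rintro ⟨s, t, u, v, z⟩ hq
    simp only [Set.Finite.coe_toFinset, Set.mem_ofPred_eq, paramSet] at hq
    obtain ⟨⟨⟨hs, ht, hu, hv, hz⟩, hst, huv, h1, h2, heq, hB⟩, hlt⟩ := hq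
    have hsq : ((max s t : ℤ) : ℝ) < √B := by
      have a0 : (0 : ℝ) < ((max s t : ℤ) : ℝ) := by exact_mod_cast lt_max_of_lt_left hs
      have a1 : ((max s t : ℤ) : ℝ) < ((max u v : ℤ) : ℝ) := by exact_mod_cast hlt
      rw [Real.lt_sqrt a0.le]
      nlinarith
    have hs' : (s : ℝ) < √B := lt_of_le_of_lt (by exact_mod_cast le_max_left s t) hsq
    have ht' : (t : ℝ) < √B := lt_of_le_of_lt (by exact_mod_cast le_max_right s t) hsq
    simp only [coe_filter, mem_product, mem_Icc, Set.mem_ofPred_eq]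
    refine ⟨⟨⟨hs, Int.le_floor.2 hs'.le⟩, ht, Int.le_floor.2 ht'.le⟩, hs', ht', hst, fun h => h1 ?_⟩
    nlinarith

theorem ncard_paramSet_gt_eq_lt (B : ℝ) :
    {q ∈ paramSet B | max q.2.2.1 q.2.2.2.1 < max q.1 q.2.1}.ncard =
      {q ∈ paramSet B | max q.1 q.2.1 < max q.2.2.1 q.2.2.2.1}.ncard := by
  have key : ∀ s t u v z : ℤ, (s, t, u, v, z) ∈ paramSet B → (v, u, t, s, z) ∈ paramSet B := by
    rintro s t u v z ⟨⟨hs, ht, hu, hv, hz⟩, hst, huv, h1, h2, heq, hB⟩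
    dsimp only at *
    refine ⟨⟨hv, hu, ht, hs, hz⟩, ?_, ?_, h2.symm, h1.symm, ?_, ?_⟩
    · rw [Int.gcd_comm]; exact huv
    · rw [Int.gcd_comm]; exact hst
    · dsimp only; linear_combination heq
    · dsimp only; rw [max_comm v u, max_comm t s, mul_comm]; exact hB
  refine Set.ncard_congr (fun q _ => (q.2.2.2.1, q.2.2.1, q.2.1, q.1, q.2.2.2.2)) ?_ ?_ ?_
  · rintro ⟨s, t, u, v, z⟩ ⟨h, hlt⟩
    exact ⟨key _ _ _ _ _ h, by simpa only [max_comm v u, max_comm t s] using hlt⟩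
  · rintro ⟨s, t, u, v, z⟩ ⟨s', t', u', v', z'⟩ - - h
    simp only [Prod.mk.injEq] at h ⊢
    tauto
  · rintro ⟨s, t, u, v, z⟩ ⟨h, hlt⟩
    exact ⟨(v, u, t, s, z), ⟨key _ _ _ _ _ h, by simpa only [max_comm v u, max_comm t s] using hlt⟩,
      rfl⟩

theorem None_eq_add (B : ℝ) :
    None B = 2 * {q ∈ paramSet B | max q.1 q.2.1 < max q.2.2.1 q.2.2.2.1}.ncard +
      {q ∈ paramSet B | max q.1 q.2.1 = max q.2.2.1 q.2.2.2.1}.ncard := by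
  have hfin : ∀ p : ℤ × ℤ × ℤ × ℤ × ℤ → Prop, {q ∈ paramSet B | p q}.Finite := fun p =>
    (finite_paramSet B).subset (Set.sep_subset _ _)
  have hsplit : paramSet B = ({q ∈ paramSet B | max q.1 q.2.1 < max q.2.2.1 q.2.2.2.1} ∪
      {q ∈ paramSet B | max q.2.2.1 q.2.2.2.1 < max q.1 q.2.1}) ∪
      {q ∈ paramSet B | max q.1 q.2.1 = max q.2.2.1 q.2.2.2.1} := by
    ext q
    simp only [Set.mem_union, Set.mem_ofPred_eq]
    have := lt_trichotomy (max q.1 q.2.1) (max q.2.2.1 q.2.2.2.1)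
    tauto
  rw [None_eq_ncard_paramSet]
  conv_lhs => rw [hsplit]
  rw [Set.ncard_union_eq _ ((hfin _).union (hfin _)) (hfin _),
    Set.ncard_union_eq _ (hfin _) (hfin _), ncard_paramSet_gt_eq_lt]
  · ring
  · rw [Set.disjoint_left]
    rintro q ⟨-, h⟩ ⟨-, h'⟩
    exact lt_asymm h h'
  · rw [Set.disjoint_left]
    rintro q (⟨-, h⟩ | ⟨-, h⟩) ⟨-, h'⟩
    · exact h.ne h'
    · exact h.ne' h'

theorem ncard_le_sum_card_divisors {α : Type*} {H : ℕ} {P : ℕ → Finset ℕ} {K : ℕ → ℕ → ℕ}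
    {c : ℕ → ℕ → ℤ} (hK : ∀ m ∈ Icc 1 H, ∀ p ∈ P m, 0 < K m p)
    (hc : ∀ m ∈ Icc 1 H, ∀ p ∈ P m, IsCoprime (c m p) (K m p)) {S : Set α} (g : α → ℕ × ℕ × ℤ)
    (hg : ∀ q ∈ S, (g q).1 ∈ Icc 1 H ∧ (g q).2.1 ∈ P (g q).1 ∧
      (g q).2.2 ∈ Icc (1 : ℤ) ((2 * (g q).1 ^ 2 : ℕ) : ℤ) ∧
      (K (g q).1 (g q).2.1 : ℤ) ∣ 2 * ((g q).2.2 ^ 2 - c (g q).1 (g q).2.1))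
    (hinj : Set.InjOn g S) :
    (S.ncard : ℝ) ≤ ∑ m ∈ Icc 1 H, ∑ p ∈ P m,
      ((K m p).divisors.card : ℝ) * (32 * m ^ 2 / (K m p : ℝ) + 1) := by
  set A : ℕ → ℕ → Finset ℤ := fun m p =>
    (Icc (1 : ℤ) ((2 * m ^ 2 : ℕ) : ℤ)).filter (fun z => (K m p : ℤ) ∣ 2 * (z ^ 2 - c m p))
  set T : Finset (Σ _ : ℕ, Σ _ : ℕ, ℤ) := (Icc 1 H).sigma fun m => (P m).sigma fun p => A m p
  have hST : S.ncard ≤ T.card := by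
    rw [← Set.ncard_coe_finset]
    refine Set.ncard_le_ncard_of_injOn (fun q => ⟨(g q).1, (g q).2.1, (g q).2.2⟩) ?_ ?_
      T.finite_toSet
    · intro q hq
      obtain ⟨h1, h2, h3, h4⟩ := hg q hq
      simp only [T, A, coe_sigma, Set.mem_sigma_iff, mem_coe, mem_filter]
      exact ⟨h1, h2, h3, h4⟩
    · intro x hx y hy h
      refine hinj hx hy ?_
      simp only [Sigma.mk.injEq, heq_eq_eq] at h
      exact Prod.ext h.1 (Prod.ext h.2.1 h.2.2)
  calc (S.ncard : ℝ) ≤ T.card := by exact_mod_cast hST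
    _ = ∑ m ∈ Icc 1 H, ∑ p ∈ P m, ((A m p).card : ℝ) := by
        simp only [T, card_sigma]; push_cast; rfl
    _ ≤ _ := by
        refine sum_le_sum fun m hm => sum_le_sum fun p hp => ?_
        refine (card_roots_le (hK m hm p hp) (hc m hm p hp) _).trans (le_of_eq ?_)
        push_cast
        ring

theorem ncard_le_of_sq_add_sq {α : Type*} {H : ℕ} {c : ℕ → ℕ → ℤ}
    (hc : ∀ m p : ℕ, Nat.Coprime m p → IsCoprime (c m p) ((m ^ 2 + p ^ 2 : ℕ) : ℤ)) {S : Set α}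
    (g : α → ℕ × ℕ × ℤ)
    (hg : ∀ q ∈ S, (g q).1 ∈ Icc 1 H ∧ (g q).2.1 ∈ (Icc 1 H).filter (Nat.Coprime (g q).1) ∧
      (g q).2.2 ∈ Icc (1 : ℤ) ((2 * (g q).1 ^ 2 : ℕ) : ℤ) ∧
      (((g q).1 ^ 2 + (g q).2.1 ^ 2 : ℕ) : ℤ) ∣ 2 * ((g q).2.2 ^ 2 - c (g q).1 (g q).2.1))
    (hinj : Set.InjOn g S) :
    (S.ncard : ℝ) ≤ 1188 * (H : ℝ) ^ 2 * (1 + Real.log (2 * H)) ^ 2 := by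
  have h := ncard_le_sum_card_divisors (H := H) (P := fun m => (Icc 1 H).filter (Nat.Coprime m))
    (K := fun m p => m ^ 2 + p ^ 2) (c := c)
    (fun m hm p _ => by have := (mem_Icc.1 hm).1; positivity)
    (fun m _ p hp => hc m p (mem_filter.1 hp).2) g hg hinj
  refine h.trans ?_
  calc _ ≤ ∑ m ∈ Icc 1 H, ∑ p ∈ (Icc 1 H).filter (Nat.Coprime m),
        ((m ^ 2 + p ^ 2).divisors.card : ℝ) * 33 := by
        gcongr with m hm p hp
        have hm := (mem_Icc.1 hm).1
        have : 32 * (m : ℝ) ^ 2 / ((m ^ 2 + p ^ 2 : ℕ) : ℝ) ≤ 32 := by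
          rw [div_le_iff₀ (by positivity)]
          push_cast
          nlinarith [sq_nonneg (p : ℝ)]
        linarith
    _ ≤ 36 * (H : ℝ) ^ 2 * (1 + Real.log (2 * H)) ^ 2 * 33 := by
        simp_rw [← sum_mul]
        gcongr
        exact sum_card_divisors_sq_add_sq_le
    _ = _ := by ring

theorem coprime_sq_add_sq {m p : ℕ} (h : Nat.Coprime m p) :
    IsCoprime (m : ℤ) ((m ^ 2 + p ^ 2 : ℕ) : ℤ) ∧ IsCoprime (p : ℤ) ((m ^ 2 + p ^ 2 : ℕ) : ℤ) := by
  rw [Nat.isCoprime_iff_coprime, Nat.isCoprime_iff_coprime]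
  constructor
  · rw [sq m, Nat.coprime_mul_right_add_right]
    exact h.pow_right 2
  · rw [sq p, Nat.coprime_add_mul_right_right]
    exact h.symm.pow_right 2

theorem coprime_sq_sub_sq {m p : ℕ} (h : Nat.Coprime m p) (hpm : p < m) :
    IsCoprime (m : ℤ) ((m ^ 2 - p ^ 2 : ℕ) : ℤ) ∧ IsCoprime (p : ℤ) ((m ^ 2 - p ^ 2 : ℕ) : ℤ) := by
  rw [Nat.cast_sub (by gcongr)]
  have h' : IsCoprime (m : ℤ) p := Nat.isCoprime_iff_coprime.2 h
  push_cast
  constructor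
  · rw [show (m : ℤ) ^ 2 - p ^ 2 = -p ^ 2 + m * m by ring]
    exact (h'.pow_right (n := 2)).neg_right.add_mul_left_right (m : ℤ)
  · rw [show (m : ℤ) ^ 2 - p ^ 2 = m ^ 2 + p * -p by ring]
    exact (h'.symm.pow_right (n := 2)).add_mul_left_right (-p : ℤ)

theorem ncard_le_of_sq_sub_sq {α : Type*} {H : ℕ} {S : Set α} (g : α → ℕ × ℕ × ℤ)
    (hg : ∀ q ∈ S, (g q).1 ∈ Icc 1 H ∧ (g q).2.1 ∈ (Icc 1 H).filter (· < (g q).1) ∧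
      (g q).1.Coprime (g q).2.1 ∧
      (g q).2.2 ∈ Icc (1 : ℤ) ((2 * (g q).1 ^ 2 : ℕ) : ℤ) ∧
      (((g q).1 ^ 2 - (g q).2.1 ^ 2 : ℕ) : ℤ) ∣ 2 * ((g q).2.2 ^ 2 - ((g q).1 * (g q).2.1) ^ 2))
    (hinj : Set.InjOn g S) :
    (S.ncard : ℝ) ≤ 132 * (H : ℝ) ^ 2 * (1 + Real.log (2 * H)) ^ 3 := by
  have hlt : ∀ m p : ℕ, p < m → 0 < m ^ 2 - p ^ 2 := fun m p h =>
    Nat.sub_pos_of_lt (by gcongr)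
  have h := ncard_le_sum_card_divisors (H := H)
    (P := fun m => ((Icc 1 H).filter (· < m)).filter (Nat.Coprime m))
    (K := fun m p => m ^ 2 - p ^ 2) (c := fun m p => ((m : ℤ) * p) ^ 2)
    (fun m hm p hp => hlt m p (mem_filter.1 (mem_filter.1 hp).1).2)
    (fun m _ p hp => by
      obtain ⟨h1, h2⟩ := coprime_sq_sub_sq (mem_filter.1 hp).2
        (mem_filter.1 (mem_filter.1 hp).1).2
      exact (h1.mul_left h2).pow_left) g
    (fun q hq => by
      obtain ⟨h1, h2, h3, h4, h5⟩ := hg q hq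
      exact ⟨h1, mem_filter.2 ⟨h2, h3⟩, h4, h5⟩) hinj
  refine (h.trans ?_).trans sum_card_divisors_sq_sub_sq_le
  gcongr with m hm
  exact filter_subset _ _

/-- The points of the parameter set with both maxima equal to the coordinates selected
by `i` and `j`. -/
def diagPiece (B : ℝ) (i j : ℤ × ℤ × ℤ × ℤ × ℤ → ℤ) : Set (ℤ × ℤ × ℤ × ℤ × ℤ) :=
  {q | q ∈ paramSet B ∧ i q = max q.1 q.2.1 ∧ j q = max q.2.2.1 q.2.2.2.1 ∧ i q = j q}

theorem le_floor_sqrt_of_sq_le {m : ℕ} {B : ℝ} (h : (m : ℝ) * m ≤ B) : m ≤ ⌊√B⌋₊ :=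
  Nat.le_floor (Real.le_sqrt_of_sq_le (by rwa [sq]))

theorem ncard_diagPiece_s_u (B : ℝ) :
    ((diagPiece B (fun q => q.1) (fun q => q.2.2.1)).ncard : ℝ) ≤
      1188 * (⌊√B⌋₊ : ℝ) ^ 2 * (1 + Real.log (2 * ⌊√B⌋₊)) ^ 2 := by
  refine ncard_le_of_sq_add_sq (c := fun m p => -((m : ℤ) * p) ^ 2) ?_
    (fun q => (q.1.toNat, q.2.1.toNat, q.2.2.2.2)) ?_ ?_
  · intro m p h
    obtain ⟨h1, h2⟩ := coprime_sq_add_sq h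
    exact (h1.mul_left h2).pow_left.neg_left
  · rintro ⟨s, t, u, v, z⟩ ⟨hq, hs, hu, hsu⟩
    have hz := paramSet_z_le hq
    obtain ⟨⟨hs0, ht0, hu0, hv0, hz0⟩, hst, huv, h1, h2, heq, hB⟩ := hq
    dsimp only at *
    rw [← hs, ← hu] at hz hB
    have hts : t ≤ s := hs ▸ le_max_right s t
    subst hsu
    lift s to ℕ using hs0.le
    lift t to ℕ using ht0.le
    simp only [Int.toNat_natCast, mem_filter, mem_Icc]
    have hm := le_floor_sqrt_of_sq_le hB
    refine ⟨⟨by omega, hm⟩, ⟨⟨by omega, by omega⟩, by simpa using hst⟩, ⟨hz0, ?_⟩, ?_⟩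
    · push_cast; linarith
    · refine ⟨s ^ 2 + v ^ 2, ?_⟩
      push_cast
      linear_combination -heq
  · rintro ⟨s, t, u, v, z⟩ ⟨⟨⟨hs0, ht0, hu0, hv0, hz0⟩, -, -, -, -, heq, -⟩, -, -, hsu⟩
      ⟨s', t', u', v', z'⟩ ⟨⟨⟨hs0', ht0', hu0', hv0', hz0'⟩, -, -, -, -, heq', -⟩, -, -, hsu'⟩ h
    simp only [Prod.mk.injEq] at *
    obtain ⟨h1, h2, rfl⟩ := h
    obtain rfl : s = s' := by omega
    obtain rfl : t = t' := by omega
    subst hsu hsu'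
    obtain rfl : v = v' := by
      have : v ^ 2 = v' ^ 2 := by
        apply mul_left_cancel₀ (by positivity : s ^ 2 + t ^ 2 ≠ 0)
        linear_combination heq - heq'
      exact (pow_left_inj₀ hv0.le hv0'.le two_ne_zero).1 this
    simp

theorem ncard_diagPiece_t_v (B : ℝ) :
    ((diagPiece B (fun q => q.2.1) (fun q => q.2.2.2.1)).ncard : ℝ) ≤
      1188 * (⌊√B⌋₊ : ℝ) ^ 2 * (1 + Real.log (2 * ⌊√B⌋₊)) ^ 2 := by
  refine ncard_le_of_sq_add_sq (c := fun m p => -((m : ℤ) * p) ^ 2) ?_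
    (fun q => (q.2.1.toNat, q.2.2.1.toNat, q.2.2.2.2)) ?_ ?_
  · intro m p h
    obtain ⟨h1, h2⟩ := coprime_sq_add_sq h
    exact (h1.mul_left h2).pow_left.neg_left
  · rintro ⟨s, t, u, v, z⟩ ⟨hq, ht, hv, htv⟩
    have hz := paramSet_z_le hq
    obtain ⟨⟨hs0, ht0, hu0, hv0, hz0⟩, hst, huv, h1, h2, heq, hB⟩ := hq
    dsimp only at *
    rw [← ht, ← hv] at hz hB
    have hut : u ≤ v := hv ▸ le_max_left u v
    subst htv
    lift t to ℕ using ht0.le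
    lift u to ℕ using hu0.le
    simp only [Int.toNat_natCast, mem_filter, mem_Icc]
    have hm := le_floor_sqrt_of_sq_le hB
    refine ⟨⟨by omega, hm⟩, ⟨⟨by omega, by omega⟩, by
      simpa [Nat.coprime_comm] using huv⟩, ⟨hz0, ?_⟩, ?_⟩
    · push_cast; linarith
    · refine ⟨s ^ 2 + t ^ 2, ?_⟩
      push_cast
      linear_combination -heq
  · rintro ⟨s, t, u, v, z⟩ ⟨⟨⟨hs0, ht0, hu0, hv0, hz0⟩, -, -, -, -, heq, -⟩, -, -, htv⟩
      ⟨s', t', u', v', z'⟩ ⟨⟨⟨hs0', ht0', hu0', hv0', hz0'⟩, -, -, -, -, heq', -⟩, -, -, htv'⟩ h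
    simp only [Prod.mk.injEq] at *
    obtain ⟨h1, h2, rfl⟩ := h
    obtain rfl : t = t' := by omega
    obtain rfl : u = u' := by omega
    subst htv htv'
    obtain rfl : s = s' := by
      have : s ^ 2 = s' ^ 2 := by
        apply mul_left_cancel₀ (by positivity : t ^ 2 + u ^ 2 ≠ 0)
        linear_combination heq - heq'
      exact (pow_left_inj₀ hs0.le hs0'.le two_ne_zero).1 this
    simp

theorem ncard_diagPiece_t_u (B : ℝ) :
    ((diagPiece B (fun q => q.2.1) (fun q => q.2.2.1)).ncard : ℝ) ≤
      1188 * (⌊√B⌋₊ : ℝ) ^ 2 * (1 + Real.log (2 * ⌊√B⌋₊)) ^ 2 := by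
  refine ncard_le_of_sq_add_sq (c := fun m _ => -(m : ℤ) ^ 4) ?_
    (fun q => (q.2.1.toNat, q.1.toNat, q.2.2.2.2)) ?_ ?_
  · intro m p h
    exact (coprime_sq_add_sq h).1.pow_left.neg_left
  · rintro ⟨s, t, u, v, z⟩ ⟨hq, ht, hu, htu⟩
    have hz := paramSet_z_le hq
    obtain ⟨⟨hs0, ht0, hu0, hv0, hz0⟩, hst, huv, h1, h2, heq, hB⟩ := hq
    dsimp only at *
    rw [← ht, ← hu] at hz hB
    have hst' : s ≤ t := ht ▸ le_max_left s t
    subst htu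
    lift t to ℕ using ht0.le
    lift s to ℕ using hs0.le
    simp only [Int.toNat_natCast, mem_filter, mem_Icc]
    have hm := le_floor_sqrt_of_sq_le hB
    refine ⟨⟨by omega, hm⟩, ⟨⟨by omega, by omega⟩, by
      simpa [Nat.coprime_comm] using hst⟩, ⟨hz0, ?_⟩, ?_⟩
    · push_cast; linarith
    · refine ⟨t ^ 2 + v ^ 2, ?_⟩
      push_cast
      linear_combination -heq
  · rintro ⟨s, t, u, v, z⟩ ⟨⟨⟨hs0, ht0, hu0, hv0, hz0⟩, -, -, -, -, heq, -⟩, -, -, htu⟩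
      ⟨s', t', u', v', z'⟩ ⟨⟨⟨hs0', ht0', hu0', hv0', hz0'⟩, -, -, -, -, heq', -⟩, -, -, htu'⟩ h
    simp only [Prod.mk.injEq] at *
    obtain ⟨h1, h2, rfl⟩ := h
    obtain rfl : t = t' := by omega
    obtain rfl : s = s' := by omega
    subst htu htu'
    obtain rfl : v = v' := by
      have : v ^ 2 = v' ^ 2 := by
        apply mul_left_cancel₀ (by positivity : s ^ 2 + t ^ 2 ≠ 0)
        linear_combination heq - heq'
      exact (pow_left_inj₀ hv0.le hv0'.le two_ne_zero).1 this
    simp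

theorem ncard_diagPiece_s_v (B : ℝ) :
    ((diagPiece B (fun q => q.1) (fun q => q.2.2.2.1)).ncard : ℝ) ≤
      132 * (⌊√B⌋₊ : ℝ) ^ 2 * (1 + Real.log (2 * ⌊√B⌋₊)) ^ 3 := by
  refine ncard_le_of_sq_sub_sq (fun q => (q.1.toNat, q.2.1.toNat, q.2.2.2.2)) ?_ ?_
  · rintro ⟨s, t, u, v, z⟩ ⟨hq, hs, hv, hsv⟩
    have hz := paramSet_z_le hq
    obtain ⟨⟨hs0, ht0, hu0, hv0, hz0⟩, hst, huv, h1, h2, heq, hB⟩ := hq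
    dsimp only at *
    rw [← hs, ← hv] at hz hB
    have hts : t < s := lt_of_le_of_ne (hs ▸ le_max_right s t) h1.symm
    subst hsv
    lift s to ℕ using hs0.le
    lift t to ℕ using ht0.le
    simp only [Int.toNat_natCast, mem_filter, mem_Icc]
    have hm := le_floor_sqrt_of_sq_le hB
    refine ⟨⟨by omega, hm⟩, ⟨⟨by omega, by omega⟩, by omega⟩, by simpa using hst, ⟨hz0, ?_⟩, ?_⟩
    · push_cast; linarith
    · rw [Nat.cast_sub (Nat.pow_le_pow_left (by omega) 2)]
      refine ⟨u ^ 2 + s ^ 2, ?_⟩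
      push_cast
      linear_combination -heq
  · rintro ⟨s, t, u, v, z⟩ ⟨⟨⟨hs0, ht0, hu0, hv0, hz0⟩, -, -, hne, -, heq, -⟩, hs, -, hsv⟩
      ⟨s', t', u', v', z'⟩ ⟨⟨⟨hs0', ht0', hu0', hv0', hz0'⟩, -, -, -, -, heq', -⟩, -, -, hsv'⟩ h
    simp only [Prod.mk.injEq] at *
    obtain ⟨h1, h2, rfl⟩ := h
    obtain rfl : s = s' := by omega
    obtain rfl : t = t' := by omega
    subst hsv hsv'
    have hts : t < s := lt_of_le_of_ne (hs ▸ le_max_right s t) hne.symm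
    obtain rfl : u = u' := by
      have : u ^ 2 = u' ^ 2 := by
        apply mul_left_cancel₀ (by nlinarith : s ^ 2 - t ^ 2 ≠ 0)
        linear_combination heq - heq'
      exact (pow_left_inj₀ hu0.le hu0'.le two_ne_zero).1 this
    simp

theorem ncard_diagonal_le (B : ℝ) :
    (({q ∈ paramSet B | max q.1 q.2.1 = max q.2.2.1 q.2.2.2.1}.ncard : ℕ) : ℝ) ≤
      3 * (1188 * (⌊√B⌋₊ : ℝ) ^ 2 * (1 + Real.log (2 * ⌊√B⌋₊)) ^ 2) +
        132 * (⌊√B⌋₊ : ℝ) ^ 2 * (1 + Real.log (2 * ⌊√B⌋₊)) ^ 3 := by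
  set D₁ := diagPiece B (fun q => q.1) (fun q => q.2.2.1)
  set D₂ := diagPiece B (fun q => q.2.1) (fun q => q.2.2.2.1)
  set D₃ := diagPiece B (fun q => q.2.1) (fun q => q.2.2.1)
  set D₄ := diagPiece B (fun q => q.1) (fun q => q.2.2.2.1)
  have hsub : {q ∈ paramSet B | max q.1 q.2.1 = max q.2.2.1 q.2.2.2.1} ⊆
      (D₁ ∪ D₂) ∪ (D₃ ∪ D₄) := by
    rintro q ⟨hq, h⟩
    rcases max_choice q.1 q.2.1 with h1 | h1 <;> rcases max_choice q.2.2.1 q.2.2.2.1 with h2 | h2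
    · exact Or.inl (Or.inl ⟨hq, h1.symm, h2.symm, h1.symm.trans (h.trans h2)⟩)
    · exact Or.inr (Or.inr ⟨hq, h1.symm, h2.symm, h1.symm.trans (h.trans h2)⟩)
    · exact Or.inr (Or.inl ⟨hq, h1.symm, h2.symm, h1.symm.trans (h.trans h2)⟩)
    · exact Or.inl (Or.inr ⟨hq, h1.symm, h2.symm, h1.symm.trans (h.trans h2)⟩)
  have hfin : ∀ i j, (diagPiece B i j).Finite := fun i j =>
    (finite_paramSet B).subset fun q hq => hq.1
  have h0 := Set.ncard_le_ncard hsub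
    (((hfin _ _).union (hfin _ _)).union ((hfin _ _).union (hfin _ _)))
  have h1 := Set.ncard_union_le (D₁ ∪ D₂) (D₃ ∪ D₄)
  have h2 := Set.ncard_union_le D₁ D₂
  have h3 := Set.ncard_union_le D₃ D₄
  have h4 : (({q ∈ paramSet B | max q.1 q.2.1 = max q.2.2.1 q.2.2.2.1}.ncard : ℕ) : ℝ) ≤
      D₁.ncard + D₂.ncard + (D₃.ncard + D₄.ncard) := by
    exact_mod_cast h0.trans (h1.trans (by omega))
  have := ncard_diagPiece_s_u B
  have := ncard_diagPiece_t_v B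
  have := ncard_diagPiece_t_u B
  have := ncard_diagPiece_s_v B
  linarith

theorem one_add_log_two_mul_floor_sqrt_le {B : ℝ} (hB : 3 ≤ B) :
    1 ≤ Real.log B ∧ 1 ≤ ⌊√B⌋₊ ∧ 1 + Real.log (2 * ⌊√B⌋₊) ≤ 3 * Real.log B := by
  have h1 : 1 ≤ Real.log B := by
    rw [Real.le_log_iff_exp_le (by linarith)]
    linarith [Real.exp_one_lt_d9]
  have h2 : 1 ≤ ⌊√B⌋₊ := Nat.le_floor (by rw [Nat.cast_one, Real.one_le_sqrt]; linarith)
  refine ⟨h1, h2, ?_⟩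
  have h3 : (1 : ℝ) ≤ ⌊√B⌋₊ := by exact_mod_cast h2
  have h4 : (⌊√B⌋₊ : ℝ) ≤ B :=
    (Nat.floor_le (Real.sqrt_nonneg B)).trans (Real.sqrt_le_iff.2 ⟨by linarith, by nlinarith⟩)
  rw [Real.log_mul (by norm_num) (by linarith)]
  have := Real.log_le_log (by linarith) h4
  linarith [Real.log_two_lt_d9]

end

theorem None_eq_twice_sum_Mtilde :
    ∃ C : ℝ, 0 < C ∧ ∀ B : ℝ, 3 ≤ B →
      |(None B : ℝ) -
          2 * ∑ q ∈ (Finset.Icc (1 : ℤ) ⌊Real.sqrt B⌋ ×ˢ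
              Finset.Icc (1 : ℤ) ⌊Real.sqrt B⌋).filter
              (fun q => (q.1 : ℝ) < Real.sqrt B ∧ (q.2 : ℝ) < Real.sqrt B ∧
                Int.gcd q.1 q.2 = 1 ∧ q.1 * q.2 ≠ 1),
            (Mtilde q.1 q.2 B : ℝ)| ≤ C * B * Real.log B ^ 3 := by
  refine ⟨100000, by norm_num, fun B hB => ?_⟩
  rw [None_eq_add B, ncard_paramSet_lt_eq_sum B]
  push_cast
  rw [add_sub_cancel_left, abs_of_nonneg (Nat.cast_nonneg _)]
  refine (ncard_diagonal_le B).trans ?_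
  obtain ⟨h1, h2, h3⟩ := one_add_log_two_mul_floor_sqrt_le hB
  have hH : (⌊√B⌋₊ : ℝ) ^ 2 ≤ B := by
    calc (⌊√B⌋₊ : ℝ) ^ 2 ≤ √B ^ 2 := by gcongr; exact Nat.floor_le (Real.sqrt_nonneg B)
      _ = B := Real.sq_sqrt (by linarith)
  have hH1 : (1 : ℝ) ≤ ⌊√B⌋₊ := by exact_mod_cast h2
  have hl : 0 ≤ 1 + Real.log (2 * ⌊√B⌋₊) := by
    have := Real.log_nonneg (by linarith : (1 : ℝ) ≤ 2 * ⌊√B⌋₊)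
    linarith
  have hB0 : 0 ≤ B := by linarith
  calc _ ≤ 3 * (1188 * B * (3 * Real.log B) ^ 2) + 132 * B * (3 * Real.log B) ^ 3 := by gcongr
    _ = 32076 * B * Real.log B ^ 2 + 3564 * B * Real.log B ^ 3 := by ring
    _ ≤ 32076 * B * Real.log B ^ 3 + 3564 * B * Real.log B ^ 3 := by
        gcongr 32076 * B * ?_ + _
        exact pow_le_pow_right₀ h1 (by norm_num)
    _ ≤ _ := by
        have : 0 ≤ B * Real.log B ^ 3 := by positivity
        linarith
end

section
/- There exists a constant C > 0 such that for every real B ≥ 3 and every real T > 0 one has ∑_{(a,b)} M_{a,b}(B) ≤ C·B·(log B)³·log(T + 2), where the sum is over ordered pairs (a,b) of positive integers with gcd(a,b) = 1, ab ≠ 1 and √B/T < max{a,b} ≤ √B. -/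
open scoped Classical

/-- `M_{a,b}(B)`: the number of positive integer triples `(x,y,z)` with
`(a²−b²)x² + (a²+b²)y² = 2z²`, `gcd(x,y) = 1` and `max{a,b}·max{x,y} ≤ B`. -/
noncomputable def Mcount (a b : ℤ) (B : ℝ) : ℕ :=
  Set.ncard {p : ℤ × ℤ × ℤ |
    0 < p.1 ∧ 0 < p.2.1 ∧ 0 < p.2.2 ∧
    (a ^ 2 - b ^ 2) * p.1 ^ 2 + (a ^ 2 + b ^ 2) * p.2.1 ^ 2 = 2 * p.2.2 ^ 2 ∧
    Int.gcd p.1 p.2.1 = 1 ∧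
    ((max a b : ℤ) : ℝ) * ((max p.1 p.2.1 : ℤ) : ℝ) ≤ B}

theorem card_le_of_separated {α : Type*} (S : Finset α) (f : α → ℝ) {l len δ : ℝ} (hδ : 0 < δ)
    (hlen : 0 ≤ len) (hf : ∀ s ∈ S, l ≤ f s ∧ f s ≤ l + len)
    (hsep : ∀ s ∈ S, ∀ t ∈ S, s ≠ t → δ ≤ |f s - f t|) :
    (S.card : ℝ) ≤ 1 + len / δ := by
  have h : S.card ≤ (Finset.range (⌊len / δ⌋₊ + 1)).card := by
    apply Finset.card_le_card_of_injOn (fun s => ⌊(f s - l) / δ⌋₊)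
    · intro s hs
      have := hf s hs
      simp only [Finset.coe_range, Set.mem_Iio]
      refine Nat.lt_succ_of_le (Nat.floor_le_floor ?_)
      gcongr
      linarith
    · intro s hs t ht hst
      by_contra hne
      have h1 := hsep s hs t ht hne
      have h2 : |(f s - l) / δ - (f t - l) / δ| < 1 := by
        simp only at hst
        have a1 := Nat.floor_le (div_nonneg (sub_nonneg.2 (hf s hs).1) hδ.le)
        have a2 := Nat.lt_floor_add_one ((f s - l) / δ)
        have b1 := Nat.floor_le (div_nonneg (sub_nonneg.2 (hf t ht).1) hδ.le)
        have b2 := Nat.lt_floor_add_one ((f t - l) / δ)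
        rw [hst] at a1 a2
        rw [abs_lt]
        constructor <;> linarith
      rw [← sub_div, abs_div, abs_of_pos hδ, div_lt_one hδ, sub_sub_sub_cancel_right] at h2
      linarith
  rw [Finset.card_range] at h
  have h3 := Nat.floor_le (div_nonneg hlen hδ.le)
  have : (S.card : ℝ) ≤ (⌊len / δ⌋₊ : ℝ) + 1 := by exact_mod_cast h
  linarith

/-- Integer vectors with slopes in a short interval and large pairwise determinants are few. -/
theorem card_le_of_det {α : Type*} (S : Finset α) (p q : α → ℤ) {l len W D : ℝ} (hD : 0 < D)
    (hlen : 0 ≤ len) (hW : 0 < W) (hq : ∀ s ∈ S, q s ≠ 0) (hqW : ∀ s ∈ S, (q s : ℝ) ^ 2 ≤ W)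
    (hf : ∀ s ∈ S, l ≤ (p s : ℝ) / q s ∧ (p s : ℝ) / q s ≤ l + len)
    (hdet : ∀ s ∈ S, ∀ t ∈ S, s ≠ t → D ≤ |(p s : ℝ) * q t - p t * q s|) :
    (S.card : ℝ) ≤ 1 + len * W / D := by
  have := card_le_of_separated S (fun s => (p s : ℝ) / q s) (l := l) (len := len) (δ := D / W)
    (by positivity) hlen hf ?_
  · rwa [div_div_eq_mul_div] at this
  intro s hs t ht hst
  have hs0 : (q s : ℝ) ≠ 0 := by exact_mod_cast hq s hs
  have ht0 : (q t : ℝ) ≠ 0 := by exact_mod_cast hq t ht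
  have hqq : |(q s : ℝ) * q t| ≤ W := by
    rw [abs_le]
    constructor <;> nlinarith [hqW s hs, hqW t ht, sq_nonneg ((q s : ℝ) - q t),
      sq_nonneg ((q s : ℝ) + q t)]
  have hpos : 0 < |(q s : ℝ) * q t| := by positivity
  have e : (p s : ℝ) / q s - p t / q t = (p s * q t - p t * q s) / (q s * q t) := by
    field_simp
  rw [e, abs_div]
  exact div_le_div₀ (abs_nonneg _) (hdet s hs t ht hst) hpos hqq

theorem isCoprime_sq_add_sq {a b : ℤ} (h : IsCoprime a b) : IsCoprime a (a ^ 2 + b ^ 2) := by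
  have e : a ^ 2 + b ^ 2 = b ^ 2 + a * a := by ring
  rw [e]
  exact (IsCoprime.pow_right h).add_mul_left_right a

/-- Parametrisation of the conic from its point `(1, 1, a)`. -/
theorem exists_conic_param {a b x y z : ℤ} (hb : b ≠ 0) (hab : a ^ 2 ≠ b ^ 2)
    (hxy : IsCoprime x y) (hne : x ≠ y)
    (h : (a ^ 2 - b ^ 2) * x ^ 2 + (a ^ 2 + b ^ 2) * y ^ 2 = 2 * z ^ 2) :
    ∃ u v g m : ℤ, IsCoprime u v ∧ v ≠ 0 ∧ g ≠ 0 ∧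
      2 * ((a ^ 2 + b ^ 2) * v - 2 * a * u) = m * g ∧
      g * x = 2 * u ^ 2 - (a ^ 2 + b ^ 2) * v ^ 2 ∧
      g * y = 2 * u ^ 2 - 4 * a * u * v + (a ^ 2 + b ^ 2) * v ^ 2 ∧
      g * z = -2 * a * u ^ 2 + 2 * (a ^ 2 + b ^ 2) * u * v - a * (a ^ 2 + b ^ 2) * v ^ 2 := by
  have hC : a ^ 2 + b ^ 2 ≠ 0 := by positivity
  have hyx : y - x ≠ 0 := sub_ne_zero.2 (Ne.symm hne)
  have hm0 : ((Int.gcd (z - a * x) (y - x) : ℕ) : ℤ) ≠ 0 := by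
    intro h0
    have := Int.gcd_eq_zero_iff.1 (by exact_mod_cast h0)
    exact hyx this.2
  obtain ⟨u, hu⟩ := Int.gcd_dvd_left (z - a * x) (y - x)
  obtain ⟨v, hv⟩ := Int.gcd_dvd_right (z - a * x) (y - x)
  have hbez := Int.gcd_eq_gcd_ab (z - a * x) (y - x)
  generalize ((Int.gcd (z - a * x) (y - x) : ℕ) : ℤ) = m at *
  have huv : IsCoprime u v := by
    refine ⟨Int.gcdA (z - a * x) (y - x), Int.gcdB (z - a * x) (y - x), ?_⟩
    apply mul_left_cancel₀ hm0
    linear_combination -hbez - Int.gcdA (z - a * x) (y - x) * hu - Int.gcdB (z - a * x) (y - x) * hv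
  have hv0 : v ≠ 0 := by
    rintro rfl
    simp [hv] at hyx
  have hX : 2 * ((a ^ 2 + b ^ 2) * v - 2 * a * u) * x =
      m * (2 * u ^ 2 - (a ^ 2 + b ^ 2) * v ^ 2) := by
    have hy : y = x + m * v := by linarith
    have hz : z = a * x + m * u := by linarith
    apply mul_left_cancel₀ hm0
    subst hy hz
    linear_combination h
  have hY : 2 * ((a ^ 2 + b ^ 2) * v - 2 * a * u) * y =
      m * (2 * u ^ 2 - 4 * a * u * v + (a ^ 2 + b ^ 2) * v ^ 2) := by
    linear_combination hX + 2 * ((a ^ 2 + b ^ 2) * v - 2 * a * u) * hv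
  have hZ : 2 * ((a ^ 2 + b ^ 2) * v - 2 * a * u) * z =
      m * (-2 * a * u ^ 2 + 2 * (a ^ 2 + b ^ 2) * u * v - a * (a ^ 2 + b ^ 2) * v ^ 2) := by
    linear_combination a * hX + 2 * ((a ^ 2 + b ^ 2) * v - 2 * a * u) * hu
  have hmd : m ∣ 2 * ((a ^ 2 + b ^ 2) * v - 2 * a * u) := by
    obtain ⟨r, s, hrs⟩ := hxy
    refine ⟨r * (2 * u ^ 2 - (a ^ 2 + b ^ 2) * v ^ 2) +
      s * (2 * u ^ 2 - 4 * a * u * v + (a ^ 2 + b ^ 2) * v ^ 2), ?_⟩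
    linear_combination r * hX + s * hY - 2 * ((a ^ 2 + b ^ 2) * v - 2 * a * u) * hrs
  obtain ⟨g, hg⟩ := hmd
  have gx : g * x = 2 * u ^ 2 - (a ^ 2 + b ^ 2) * v ^ 2 := by
    apply mul_left_cancel₀ hm0
    linear_combination hX - x * hg
  have gy : g * y = 2 * u ^ 2 - 4 * a * u * v + (a ^ 2 + b ^ 2) * v ^ 2 := by
    apply mul_left_cancel₀ hm0
    linear_combination hY - y * hg
  have gz : g * z = -2 * a * u ^ 2 + 2 * (a ^ 2 + b ^ 2) * u * v - a * (a ^ 2 + b ^ 2) * v ^ 2 := by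
    apply mul_left_cancel₀ hm0
    linear_combination hZ - z * hg
  refine ⟨u, v, g, m, huv, hv0, ?_, hg, gx, gy, gz⟩
  rintro rfl
  have h1 : u * (u - a * v) = 0 := by linarith
  rcases mul_eq_zero.1 h1 with h1 | h1
  · subst h1
    have : (a ^ 2 + b ^ 2) * v ^ 2 = 0 := by linarith
    simp [hC, hv0] at this
  · have h2 : u = a * v := by linarith
    subst h2
    have : (a ^ 2 - b ^ 2) * v ^ 2 = 0 := by linarith
    rcases mul_eq_zero.1 this with h3 | h3
    · exact hab (by linarith)
    · exact hv0 (by simpa using h3)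

theorem conic_content_dvd {a b x y z u v g m : ℤ} (hab : IsCoprime a b)
    (huv : IsCoprime u v)
    (hg : 2 * ((a ^ 2 + b ^ 2) * v - 2 * a * u) = m * g)
    (hx : g * x = 2 * u ^ 2 - (a ^ 2 + b ^ 2) * v ^ 2)
    (hy : g * y = 2 * u ^ 2 - 4 * a * u * v + (a ^ 2 + b ^ 2) * v ^ 2)
    (hz : g * z = -2 * a * u ^ 2 + 2 * (a ^ 2 + b ^ 2) * u * v - a * (a ^ 2 + b ^ 2) * v ^ 2) :
    g ∣ 8 * Int.gcd u (a ^ 2 + b ^ 2) * Int.gcd (u - a * v) (a ^ 2 - b ^ 2) := by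
  set C := a ^ 2 + b ^ 2 with hC
  have hCA : a ^ 2 - b ^ 2 = 2 * a ^ 2 - C := by rw [hC]; ring
  set A := a ^ 2 - b ^ 2 with hA
  have haC : IsCoprime a C := isCoprime_sq_add_sq hab
  set γ := u - a * v with hγ
  have hγv : IsCoprime γ v := by
    have e : γ = u + v * -a := by rw [hγ]; ring
    rw [e]
    exact huv.add_mul_left_left (-a)
  have d1 : g ∣ 4 * u * γ := ⟨x + y, by rw [hγ]; linear_combination -hx - hy⟩
  have d2 : g ∣ 2 * C * v * γ := ⟨z + a * x, by rw [hγ]; linear_combination -hz - a * hx⟩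
  have d3 : g ∣ 2 * A * u * v := ⟨-(z + a * y), by rw [hCA]; linear_combination hz + a * hy⟩
  obtain ⟨u', hu'⟩ := Int.gcd_dvd_left u C
  obtain ⟨γ', hγ'⟩ := Int.gcd_dvd_left γ A
  have b1 := Int.gcd_eq_gcd_ab u C
  have b2 := Int.gcd_eq_gcd_ab γ A
  generalize ((Int.gcd u C : ℕ) : ℤ) = g1 at *
  generalize ((Int.gcd γ A : ℕ) : ℤ) = g2 at *
  have d4 : g ∣ 4 * γ * g1 := by
    have : g ∣ 4 * γ * C := by
      obtain ⟨r, s, hrs⟩ := huv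
      have : 4 * γ * C = r * C * (4 * u * γ) + 2 * s * (2 * C * v * γ) := by
        linear_combination -4 * γ * C * hrs
      rw [this]
      exact dvd_add (d1.mul_left _) (d2.mul_left _)
    have e : 4 * γ * g1 = Int.gcdA u C * (4 * u * γ) + Int.gcdB u C * (4 * γ * C) := by
      rw [b1]; ring
    rw [e]
    exact dvd_add (d1.mul_left _) (this.mul_left _)
  have d5 : g ∣ 4 * u * g2 := by
    have : g ∣ 4 * u * A := by
      obtain ⟨r, s, hrs⟩ := hγv
      have : 4 * u * A = r * A * (4 * u * γ) + 2 * s * (2 * A * u * v) := by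
        linear_combination -4 * u * A * hrs
      rw [this]
      exact dvd_add (d1.mul_left _) (d3.mul_left _)
    have e : 4 * u * g2 = Int.gcdA γ A * (4 * u * γ) + Int.gcdB γ A * (4 * u * A) := by
      rw [b2]; ring
    rw [e]
    exact dvd_add (d1.mul_left _) (this.mul_left _)
  obtain ⟨eu, heu⟩ := Int.gcd_dvd_left u' γ'
  obtain ⟨eγ, heγ⟩ := Int.gcd_dvd_right u' γ'
  have b3 := Int.gcd_eq_gcd_ab u' γ'
  generalize ((Int.gcd u' γ' : ℕ) : ℤ) = e at *
  have d6 : g ∣ 4 * g1 * g2 * e := by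
    have : 4 * g1 * g2 * e =
        Int.gcdA u' γ' * (4 * u * g2) + Int.gcdB u' γ' * (4 * γ * g1) := by
      linear_combination 4 * g1 * g2 * b3 - 4 * Int.gcdA u' γ' * g2 * hu' -
        4 * Int.gcdB u' γ' * g1 * hγ'
    rw [this]
    exact dvd_add (d5.mul_left _) (d4.mul_left _)
  have eu_dvd : e ∣ u := ⟨g1 * eu, by rw [hu', heu]; ring⟩
  have eγ_dvd : e ∣ γ := ⟨g2 * eγ, by rw [hγ', heγ]; ring⟩
  have ev : IsCoprime e v := huv.of_isCoprime_of_dvd_left eu_dvd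
  have ea : e ∣ a := by
    have : e ∣ a * v := by
      have := dvd_sub eu_dvd eγ_dvd
      rwa [hγ, sub_sub_cancel] at this
    exact ev.dvd_of_dvd_mul_right this
  have eCv : IsCoprime e (C * v) := (haC.of_isCoprime_of_dvd_left ea).mul_right ev
  obtain ⟨r, s, hrs⟩ := eCv
  obtain ⟨w, hw⟩ := eu_dvd
  have : 8 * g1 * g2 = (4 * g1 * g2 * e) * (2 * r + s * 4 * a * w) + g * (4 * g1 * g2 * s * m) := by
    linear_combination -8 * g1 * g2 * hrs + 4 * g1 * g2 * s * hg + 16 * g1 * g2 * s * a * hw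
  rw [this]
  exact dvd_add (d6.mul_right _) (dvd_mul_right _ _)

theorem conic_height_le {a b x y z H M : ℝ} (ha : 0 < a) (hb : 0 < b) (haH : a ≤ H) (hbH : b ≤ H)
    (hx : 0 < x) (hy : 0 < y) (hxM : x ≤ M) (hyM : y ≤ M)
    (h : (a ^ 2 - b ^ 2) * x ^ 2 + (a ^ 2 + b ^ 2) * y ^ 2 = 2 * z ^ 2) : z ≤ H * M := by
  have hH : 0 < H := ha.trans_le haH
  have hM : 0 < M := hx.trans_le hxM
  have hx2 : x ^ 2 ≤ M ^ 2 := by gcongr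
  have hy2 : y ^ 2 ≤ M ^ 2 := by gcongr
  have ha2 : a ^ 2 ≤ H ^ 2 := by gcongr
  have hb2 : b ^ 2 ≤ H ^ 2 := by gcongr
  have hz2 : z ^ 2 ≤ (H * M) ^ 2 := by
    have h1 : (a ^ 2 + b ^ 2) * y ^ 2 ≤ (a ^ 2 + b ^ 2) * M ^ 2 := by gcongr
    rcases le_total (b ^ 2) (a ^ 2) with h2 | h2
    · have h3 : (a ^ 2 - b ^ 2) * x ^ 2 ≤ (a ^ 2 - b ^ 2) * M ^ 2 :=
        mul_le_mul_of_nonneg_left hx2 (by linarith)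
      nlinarith [sq_nonneg M]
    · have h3 : (a ^ 2 - b ^ 2) * x ^ 2 ≤ 0 :=
        mul_nonpos_of_nonpos_of_nonneg (by linarith) (sq_nonneg x)
      nlinarith [sq_nonneg M]
  exact le_of_sq_le_sq hz2 (by positivity)

theorem conic_param_bounds {a b x y z u v g H M G : ℝ} (ha : 0 < a) (hb : 0 < b)
    (haH : a ≤ H) (hbH : b ≤ H) (hHC : H ^ 2 ≤ a ^ 2 + b ^ 2)
    (hx : 0 < x) (hy : 0 < y) (hxM : x ≤ M) (hyM : y ≤ M) (hz : 0 < z)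
    (h : (a ^ 2 - b ^ 2) * x ^ 2 + (a ^ 2 + b ^ 2) * y ^ 2 = 2 * z ^ 2) (hgG : |g| ≤ G)
    (hgx : g * x = 2 * u ^ 2 - (a ^ 2 + b ^ 2) * v ^ 2)
    (hgy : g * y = 2 * u ^ 2 - 4 * a * u * v + (a ^ 2 + b ^ 2) * v ^ 2)
    (hgz : g * z = -2 * a * u ^ 2 + 2 * (a ^ 2 + b ^ 2) * u * v - a * (a ^ 2 + b ^ 2) * v ^ 2) :
    |a ^ 2 - b ^ 2| * v ^ 2 ≤ 3 * (G * M) ∧ H * |v * (u - a * v)| ≤ G * M ∧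
      (2 * H * |v| ≤ |u| → u ^ 2 ≤ G * M) := by
  have hH : 0 < H := ha.trans_le haH
  have hM : 0 < M := hx.trans_le hxM
  have hG : 0 ≤ G := (abs_nonneg g).trans hgG
  have hzM := conic_height_le ha hb haH hbH hx hy hxM hyM h
  set C := a ^ 2 + b ^ 2 with hC
  have hCpos : 0 < C := by positivity
  have hCA : a ^ 2 - b ^ 2 = 2 * a ^ 2 - C := by rw [hC]; ring
  have key : ∀ w K : ℝ, |w| ≤ K → |g * w| ≤ G * K := fun w K hw => by
    rw [abs_mul]; exact mul_le_mul hgG hw (abs_nonneg _) hG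
  have e1 : 4 * |u * (u - a * v)| ≤ G * (2 * M) := by
    have := key (x + y) (2 * M) (by rw [abs_of_pos (by positivity)]; linarith)
    rw [show g * (x + y) = 4 * (u * (u - a * v)) by linear_combination hgx + hgy, abs_mul] at this
    simpa using this
  have e2 : 2 * |v * (C * v - 2 * a * u)| ≤ G * M := by
    have := key (y - x) M (by rw [abs_le]; constructor <;> linarith)
    rw [show g * (y - x) = 2 * (v * (C * v - 2 * a * u)) by linear_combination hgy - hgx,
      abs_mul] at this
    simpa using this
  have haxM : a * x ≤ H * M := by gcongr
  have hayM : a * y ≤ H * M := by gcongr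
  have e3 : 2 * C * |v * (u - a * v)| ≤ G * (2 * (H * M)) := by
    have := key (z + a * x) (2 * (H * M)) (by rw [abs_of_pos (by positivity)]; linarith)
    rw [show g * (z + a * x) = (2 * C) * (v * (u - a * v)) by linear_combination hgz + a * hgx,
      abs_mul, abs_of_pos (by positivity : 0 < 2 * C)] at this
    exact this
  have e4 : 2 * (|a ^ 2 - b ^ 2| * |u * v|) ≤ G * (2 * (H * M)) := by
    have := key (z + a * y) (2 * (H * M)) (by rw [abs_of_pos (by positivity)]; linarith)
    rw [show g * (z + a * y) = -(2 * ((a ^ 2 - b ^ 2) * (u * v))) by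
      rw [hCA]; linear_combination hgz + a * hgy, abs_neg, abs_mul, abs_mul] at this
    simpa using this
  have hAH : |a ^ 2 - b ^ 2| ≤ H ^ 2 := by
    have h1 : a ^ 2 ≤ H ^ 2 := by gcongr
    have h2 : b ^ 2 ≤ H ^ 2 := by gcongr
    rw [abs_le]; constructor <;> nlinarith
  refine ⟨?_, ?_, ?_⟩
  · have h1 : C * v ^ 2 ≤ |v * (C * v - 2 * a * u)| + 2 * a * |u * v| := by
      have h2 := le_abs_self (v * (C * v - 2 * a * u))
      have h3 : 2 * a * (u * v) ≤ 2 * a * |u * v| := by gcongr; exact le_abs_self _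
      nlinarith
    have h4 : |a ^ 2 - b ^ 2| * (C * v ^ 2) ≤ H ^ 2 * (3 * (G * M)) := by
      calc |a ^ 2 - b ^ 2| * (C * v ^ 2)
          ≤ |a ^ 2 - b ^ 2| * (|v * (C * v - 2 * a * u)| + 2 * a * |u * v|) := by gcongr
        _ = |a ^ 2 - b ^ 2| * |v * (C * v - 2 * a * u)| +
            2 * a * (|a ^ 2 - b ^ 2| * |u * v|) := by ring
        _ ≤ H ^ 2 * (G * M) + 2 * H * (G * (H * M)) := by
            have h5 : |v * (C * v - 2 * a * u)| ≤ G * M := by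
              linarith [abs_nonneg (v * (C * v - 2 * a * u))]
            have h6 : |a ^ 2 - b ^ 2| * |u * v| ≤ G * (H * M) := by linarith
            exact add_le_add (mul_le_mul hAH h5 (abs_nonneg _) (by positivity))
              (mul_le_mul (by linarith) h6 (by positivity) (by positivity))
        _ = H ^ 2 * (3 * (G * M)) := by ring
    have h5 : H ^ 2 * (|a ^ 2 - b ^ 2| * v ^ 2) ≤ H ^ 2 * (3 * (G * M)) := by
      refine le_trans ?_ h4
      calc H ^ 2 * (|a ^ 2 - b ^ 2| * v ^ 2) ≤ C * (|a ^ 2 - b ^ 2| * v ^ 2) := by gcongr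
        _ = _ := by ring
    exact le_of_mul_le_mul_left h5 (by positivity)
  · have h1 : H ^ 2 * |v * (u - a * v)| ≤ C * |v * (u - a * v)| := by gcongr
    have h2 : H * (H * |v * (u - a * v)|) ≤ H * (G * M) := by linarith
    exact le_of_mul_le_mul_left h2 hH
  · intro huv
    have h1 : a * |v| ≤ H * |v| := by gcongr
    have h2 : |u| ≤ 2 * |u - a * v| := by
      have := abs_sub_abs_le_abs_sub u (a * v)
      rw [abs_mul, abs_of_pos ha] at this
      linarith
    have h3 : |u| * |u| ≤ |u| * (2 * |u - a * v|) := by gcongr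
    rw [abs_mul] at e1
    linarith [sq_abs u, sq |u|]

theorem mul_dvd_mul_of_gcd_dvd {d e n c : ℤ} (hd : d ∣ n) (he : e ∣ n)
    (h : ((Int.gcd d e : ℕ) : ℤ) ∣ c) : d * e ∣ c * n := by
  obtain ⟨s, hs⟩ := hd
  obtain ⟨t, ht⟩ := he
  obtain ⟨k, hk⟩ := h
  have hb := Int.gcd_eq_gcd_ab d e
  refine ⟨k * (Int.gcdA d e * t + Int.gcdB d e * s), ?_⟩
  calc c * n = k * (d * Int.gcdA d e * n + e * Int.gcdB d e * n) := by
        rw [hk, hb]; ring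
    _ = _ := by
        nth_rewrite 1 [ht]
        rw [hs]; ring

theorem card_fibre_le {α : Type*} (S : Finset α) (u v : α → ℤ) {a A H M G : ℝ} (ha : 0 < a)
    (haH : a ≤ H) (hA : 0 < A) (hAH : A ≤ H ^ 2) (hM : 0 < M) (hG : 0 < G)
    (hv : ∀ s ∈ S, v s ≠ 0)
    (h1 : ∀ s ∈ S, A * (v s : ℝ) ^ 2 ≤ 3 * (G * M))
    (h2 : ∀ s ∈ S, H * |(v s : ℝ) * (u s - a * v s)| ≤ G * M)
    (h3 : ∀ s ∈ S, 2 * H * |(v s : ℝ)| ≤ |(u s : ℝ)| → (u s : ℝ) ^ 2 ≤ G * M)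
    (hdet : ∀ s ∈ S, ∀ t ∈ S, s ≠ t → G / 16 ≤ |(u s : ℝ) * v t - u t * v s|) :
    (S.card : ℝ) ≤ 3 + 176 * (M / √A) := by
  have hH : 0 < H := ha.trans_le haH
  have hL : 0 < √A := Real.sqrt_pos.2 hA
  have hLL : √A * √A = A := Real.mul_self_sqrt hA.le
  have hLH : √A ≤ H := by
    rw [← Real.sqrt_sq hH.le]; exact Real.sqrt_le_sqrt hAH
  set L := √A with hLdef
  have hvR : ∀ s ∈ S, (v s : ℝ) ≠ 0 := fun s hs => by exact_mod_cast hv s hs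
  set S1 := S.filter (fun s => |(u s : ℝ) / v s - a| ≤ L) with hS1
  set S2 := S.filter (fun s => |(u s : ℝ) / v s| ≤ 2 * H ∧ L < |(u s : ℝ) / v s - a|) with hS2
  set S3 := S.filter (fun s => 2 * H < |(u s : ℝ) / v s|) with hS3
  have hcov : S ⊆ S1 ∪ (S2 ∪ S3) := by
    intro s hs
    simp only [hS1, hS2, hS3, Finset.mem_union, Finset.mem_filter, hs, true_and]
    by_cases c1 : |(u s : ℝ) / v s - a| ≤ L
    · exact Or.inl c1
    · by_cases c2 : |(u s : ℝ) / v s| ≤ 2 * H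
      · exact Or.inr (Or.inl ⟨c2, not_le.1 c1⟩)
      · exact Or.inr (Or.inr (not_le.1 c2))
  have hcard : (S.card : ℝ) ≤ S1.card + (S2.card + S3.card) := by
    have := (Finset.card_le_card hcov).trans ((Finset.card_union_le _ _).trans
      (Nat.add_le_add_left (Finset.card_union_le _ _) _))
    exact_mod_cast this
  have b1 : (S1.card : ℝ) ≤ 1 + 2 * L * (3 * (G * M) / A) / (G / 16) := by
    refine card_le_of_det S1 u v (l := a - L) (by positivity) (by positivity) (by positivity)
      (fun s hs => hv s (Finset.mem_filter.1 hs).1) ?_ ?_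
      (fun s hs t ht => hdet s (Finset.mem_filter.1 hs).1 t (Finset.mem_filter.1 ht).1)
    · intro s hs
      rw [le_div_iff₀ hA, mul_comm]
      exact h1 s (Finset.mem_filter.1 hs).1
    · intro s hs
      have := abs_le.1 (Finset.mem_filter.1 hs).2
      constructor <;> linarith
  have b2 : (S2.card : ℝ) ≤ 1 + 4 * H * (G * M / (H * L)) / (G / 16) := by
    refine card_le_of_det S2 u v (l := -(2 * H)) (by positivity) (by positivity) (by positivity)
      (fun s hs => hv s (Finset.mem_filter.1 hs).1) ?_ ?_
      (fun s hs t ht => hdet s (Finset.mem_filter.1 hs).1 t (Finset.mem_filter.1 ht).1)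
    · intro s hs
      have hs' := Finset.mem_filter.1 hs
      rw [le_div_iff₀ (by positivity)]
      have e : |(v s : ℝ) * (u s - a * v s)| = (v s : ℝ) ^ 2 * |(u s : ℝ) / v s - a| := by
        rw [← sq_abs, sq, mul_assoc, ← abs_mul, ← abs_mul]
        congr 1
        field_simp [hvR s hs'.1]
      have h4 := h2 s hs'.1
      rw [e] at h4
      refine le_trans ?_ h4
      have h5 := hs'.2.2.le
      calc (v s : ℝ) ^ 2 * (H * L) = H * ((v s : ℝ) ^ 2 * L) := by ring
        _ ≤ _ := by gcongr
    · intro s hs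
      have := abs_le.1 (Finset.mem_filter.1 hs).2.1
      constructor <;> linarith
  have hS3u : ∀ s ∈ S3, s ∈ S ∧ 2 * H * |(v s : ℝ)| < |(u s : ℝ)| := fun s hs => by
    have hs' := Finset.mem_filter.1 hs
    refine ⟨hs'.1, ?_⟩
    have := hs'.2
    rwa [abs_div, lt_div_iff₀ (abs_pos.2 (hvR s hs'.1))] at this
  have hu0 : ∀ s ∈ S3, (u s : ℝ) ≠ 0 := fun s hs => by
    have := (hS3u s hs).2
    have h6 : 0 < |(u s : ℝ)| := lt_of_le_of_lt (by positivity) this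
    exact abs_pos.1 h6
  have b3 : (S3.card : ℝ) ≤ 1 + 1 / H * (G * M) / (G / 16) := by
    refine card_le_of_det S3 v u (l := -(1 / (2 * H))) (by positivity) (by positivity)
      (by positivity) (fun s hs => by exact_mod_cast hu0 s hs)
      (fun s hs => h3 s (hS3u s hs).1 (hS3u s hs).2.le) ?_ ?_
    · intro s hs
      have h7 : |(v s : ℝ) / u s| ≤ 1 / (2 * H) := by
        rw [abs_div, div_le_div_iff₀ (abs_pos.2 (hu0 s hs)) (by positivity)]
        linarith [(hS3u s hs).2]
      have h8 := abs_le.1 h7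
      have h9 : 1 / H = 1 / (2 * H) + 1 / (2 * H) := by field_simp; norm_num
      constructor <;> linarith
    · intro s hs t ht hst
      have := hdet s (hS3u s hs).1 t (hS3u t ht).1 hst
      rw [abs_sub_comm] at this
      convert this using 3 <;> ring
  have e1 : 2 * L * (3 * (G * M) / A) / (G / 16) = 96 * (M / L) := by
    rw [← hLL]; field_simp; norm_num
  have e2 : 4 * H * (G * M / (H * L)) / (G / 16) = 64 * (M / L) := by
    field_simp; norm_num
  have e3 : 1 / H * (G * M) / (G / 16) ≤ 16 * (M / L) := by
    have : 1 / H * (G * M) / (G / 16) = 16 * (M / H) := by field_simp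
    rw [this]
    gcongr
  linarith

/-- The number of divisors of an integer. -/
def numDivisors (n : ℤ) : ℕ := n.natAbs.divisors.card

theorem one_le_numDivisors {n : ℤ} (hn : n ≠ 0) : 1 ≤ numDivisors n :=
  Finset.card_pos.2 ⟨1, Nat.one_mem_divisors.2 (Int.natAbs_ne_zero.2 hn)⟩

theorem eq_of_coprime_of_mul_eq {x y x' y' : ℤ} (hx : 0 < x) (hx' : 0 < x') (h : IsCoprime x y)
    (h' : IsCoprime x' y') (e : x * y' = x' * y) : x = x' ∧ y = y' := by
  have d1 : x ∣ x' := h.dvd_of_dvd_mul_right (Dvd.intro _ e)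
  have d2 : x' ∣ x := h'.dvd_of_dvd_mul_right (Dvd.intro _ e.symm)
  have hxx : x = x' := Int.dvd_antisymm hx.le hx'.le d1 d2
  subst hxx
  exact ⟨rfl, (mul_left_cancel₀ hx.ne' e).symm⟩

theorem Mcount_le {a b : ℤ} (ha : 0 < a) (hb : 0 < b) (hab : IsCoprime a b) (hne : a ≠ b)
    {B : ℝ} (hB : 0 < B) :
    (Mcount a b B : ℝ) ≤ numDivisors (a ^ 2 + b ^ 2) * numDivisors (a ^ 2 - b ^ 2) *
      (4 + 176 * (B / ((max a b : ℤ) * √|(a : ℝ) ^ 2 - b ^ 2|))) := by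
  set H : ℝ := ((max a b : ℤ) : ℝ) with hHdef
  have haH : (a : ℝ) ≤ H := by rw [hHdef]; exact_mod_cast le_max_left a b
  have hbH : (b : ℝ) ≤ H := by rw [hHdef]; exact_mod_cast le_max_right a b
  have haR : (0 : ℝ) < a := by exact_mod_cast ha
  have hbR : (0 : ℝ) < b := by exact_mod_cast hb
  have hH : 0 < H := haR.trans_le haH
  have hA0 : a ^ 2 - b ^ 2 ≠ 0 := by
    intro h
    have : (a - b) * (a + b) = 0 := by linarith
    rcases mul_eq_zero.1 this with h | h
    · exact hne (by linarith)
    · linarith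
  have hC0 : a ^ 2 + b ^ 2 ≠ 0 := by positivity
  have hAR : 0 < |(a : ℝ) ^ 2 - b ^ 2| := abs_pos.2 (by exact_mod_cast hA0)
  have hHC : H ^ 2 ≤ (a : ℝ) ^ 2 + b ^ 2 := by
    rcases max_choice a b with h | h <;> rw [hHdef, h] <;> nlinarith
  have hAH : |(a : ℝ) ^ 2 - b ^ 2| ≤ H ^ 2 := by
    have h1 : (a : ℝ) ^ 2 ≤ H ^ 2 := by gcongr
    have h2 : (b : ℝ) ^ 2 ≤ H ^ 2 := by gcongr
    rw [abs_le]; constructor <;> nlinarith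
  set M := B / H with hMdef
  have hM : 0 < M := by positivity
  have hHM : H * M = B := by rw [hMdef]; field_simp
  rw [Mcount]
  set P : Set (ℤ × ℤ × ℤ) := {p : ℤ × ℤ × ℤ |
    0 < p.1 ∧ 0 < p.2.1 ∧ 0 < p.2.2 ∧
    (a ^ 2 - b ^ 2) * p.1 ^ 2 + (a ^ 2 + b ^ 2) * p.2.1 ^ 2 = 2 * p.2.2 ^ 2 ∧
    Int.gcd p.1 p.2.1 = 1 ∧
    ((max a b : ℤ) : ℝ) * ((max p.1 p.2.1 : ℤ) : ℝ) ≤ B} with hP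
  have hPM : ∀ p ∈ P, (p.1 : ℝ) ≤ M ∧ (p.2.1 : ℝ) ≤ M := by
    rintro p ⟨-, -, -, -, -, h⟩
    have h' : ((max p.1 p.2.1 : ℤ) : ℝ) ≤ M := by
      rw [hMdef, le_div_iff₀ hH, mul_comm]; exact h
    exact ⟨le_trans (by exact_mod_cast le_max_left _ _) h',
      le_trans (by exact_mod_cast le_max_right _ _) h'⟩
  have hPeq : ∀ p ∈ P, ((a : ℝ) ^ 2 - (b : ℝ) ^ 2) * (p.1 : ℝ) ^ 2 +
      ((a : ℝ) ^ 2 + (b : ℝ) ^ 2) * (p.2.1 : ℝ) ^ 2 = 2 * (p.2.2 : ℝ) ^ 2 := by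
    rintro p ⟨-, -, -, h, -, -⟩
    exact_mod_cast h
  have hPpos : ∀ p ∈ P, (0 : ℝ) < p.1 ∧ (0 : ℝ) < p.2.1 ∧ (0 : ℝ) < p.2.2 := by
    rintro p ⟨h1, h2, h3, -⟩
    exact ⟨by exact_mod_cast h1, by exact_mod_cast h2, by exact_mod_cast h3⟩
  have hPfin : P.Finite := by
    refine (Finset.finite_toSet (Finset.Icc 1 ⌊M⌋ ×ˢ Finset.Icc 1 ⌊M⌋ ×ˢ Finset.Icc 1 ⌊B⌋)).subset
      fun p hp => ?_
    obtain ⟨p1, p2, p3⟩ := hPpos p hp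
    obtain ⟨m1, m2⟩ := hPM p hp
    have hz := conic_height_le haR hbR haH hbH p1 p2 m1 m2 (hPeq p hp)
    rw [hHM] at hz
    obtain ⟨h1, h2, h3, -⟩ := hp
    simp only [Finset.coe_product, Finset.coe_Icc, Set.mem_prod, Set.mem_Icc]
    exact ⟨⟨h1, Int.le_floor.2 m1⟩, ⟨h2, Int.le_floor.2 m2⟩, h3, Int.le_floor.2 hz⟩
  set F := hPfin.toFinset.erase (1, 1, a) with hF
  have hncard : (P.ncard : ℝ) ≤ 1 + F.card := by
    rw [Set.ncard_eq_toFinset_card P hPfin]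
    have : hPfin.toFinset.card ≤ F.card + 1 := by
      rw [hF]; exact Nat.le_add_of_sub_le Finset.pred_card_le_card_erase
    have h' : (hPfin.toFinset.card : ℝ) ≤ F.card + 1 := by exact_mod_cast this
    linarith
  have hFP : ∀ p ∈ F, p ∈ P := fun p hp => hPfin.mem_toFinset.1 (Finset.mem_of_mem_erase hp)
  have hpar : ∀ p : ℤ × ℤ × ℤ, ∃ u v g m : ℤ, p ∈ F → IsCoprime u v ∧ v ≠ 0 ∧ g ≠ 0 ∧
      2 * ((a ^ 2 + b ^ 2) * v - 2 * a * u) = m * g ∧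
      g * p.1 = 2 * u ^ 2 - (a ^ 2 + b ^ 2) * v ^ 2 ∧
      g * p.2.1 = 2 * u ^ 2 - 4 * a * u * v + (a ^ 2 + b ^ 2) * v ^ 2 ∧
      g * p.2.2 = -2 * a * u ^ 2 + 2 * (a ^ 2 + b ^ 2) * u * v - a * (a ^ 2 + b ^ 2) * v ^ 2 := by
    intro p
    by_cases hp : p ∈ F
    · obtain ⟨x, y, z⟩ := p
      have hne1 := Finset.ne_of_mem_erase hp
      obtain ⟨h1, h2, h3, h4, h5, -⟩ := hFP _ hp
      simp only at h1 h2 h3 h4 h5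
      have hxy : x ≠ y := by
        rintro rfl
        have hx1 : x = 1 := by
          have : IsCoprime x x := Int.isCoprime_iff_gcd_eq_one.2 h5
          rcases Int.isUnit_iff.1 (isCoprime_self.1 this) with h | h <;> linarith
        subst hx1
        have : z = a := by nlinarith
        exact hne1 (by rw [this])
      obtain ⟨u, v, g, m, h⟩ := exists_conic_param hb.ne' (sub_ne_zero.1 hA0)
        (Int.isCoprime_iff_gcd_eq_one.2 h5) hxy h4
      exact ⟨u, v, g, m, fun _ => h⟩
    · exact ⟨0, 0, 0, 0, fun h => absurd h hp⟩
  choose u v g m hpar using hpar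
  let cls : ℤ × ℤ × ℤ → ℕ × ℕ := fun p =>
    (Int.gcd (u p) (a ^ 2 + b ^ 2), Int.gcd (u p - a * v p) (a ^ 2 - b ^ 2))
  set I := (a ^ 2 + b ^ 2).natAbs.divisors ×ˢ (a ^ 2 - b ^ 2).natAbs.divisors with hI
  have hcls : ∀ p ∈ F, cls p ∈ I := by
    intro p _
    simp only [hI, Finset.mem_product, Nat.mem_divisors, cls]
    exact ⟨⟨Int.natCast_dvd.1 (Int.gcd_dvd_right _ _), Int.natAbs_ne_zero.2 hC0⟩,
      Int.natCast_dvd.1 (Int.gcd_dvd_right _ _), Int.natAbs_ne_zero.2 hA0⟩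
  have hfib : ∀ i ∈ I, ((F.filter (fun p => cls p = i)).card : ℝ) ≤
      3 + 176 * (M / √|(a : ℝ) ^ 2 - b ^ 2|) := by
    rintro ⟨g1, g2⟩ hi
    simp only [hI, Finset.mem_product, Nat.mem_divisors] at hi
    have hg1 : 0 < g1 := Nat.pos_of_dvd_of_pos hi.1.1 (Nat.pos_of_ne_zero hi.1.2)
    have hg2 : 0 < g2 := Nat.pos_of_dvd_of_pos hi.2.1 (Nat.pos_of_ne_zero hi.2.2)
    have hg1C : (g1 : ℤ) ∣ a ^ 2 + b ^ 2 := Int.natCast_dvd.2 hi.1.1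
    have hg2A : (g2 : ℤ) ∣ a ^ 2 - b ^ 2 := Int.natCast_dvd.2 hi.2.1
    have hg12 : ((Int.gcd (g1 : ℤ) g2 : ℕ) : ℤ) ∣ 2 := by
      have k1 := (Int.gcd_dvd_left (g1 : ℤ) g2).trans hg1C
      have k2 := (Int.gcd_dvd_right (g1 : ℤ) g2).trans hg2A
      obtain ⟨r, s, hrs⟩ := (IsCoprime.pow hab : IsCoprime (a ^ 2) (b ^ 2))
      have : (2 : ℤ) = (r + s) * (a ^ 2 + b ^ 2) + (r - s) * (a ^ 2 - b ^ 2) := by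
        linear_combination -2 * hrs
      rw [this]
      exact dvd_add (k1.mul_left _) (k2.mul_left _)
    have hG : (0 : ℝ) < 8 * g1 * g2 := by positivity
    have hmem : ∀ p ∈ F.filter (fun p => cls p = (g1, g2)), p ∈ F ∧
        Int.gcd (u p) (a ^ 2 + b ^ 2) = g1 ∧ Int.gcd (u p - a * v p) (a ^ 2 - b ^ 2) = g2 := by
      intro p hp
      have := (Finset.mem_filter.1 hp).2
      simp only [cls, Prod.mk.injEq] at this
      exact ⟨(Finset.mem_filter.1 hp).1, this⟩
    have hbd : ∀ p ∈ F.filter (fun p => cls p = (g1, g2)),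
        |(a : ℝ) ^ 2 - b ^ 2| * (v p : ℝ) ^ 2 ≤ 3 * ((8 * g1 * g2) * M) ∧
        H * |(v p : ℝ) * (u p - a * v p)| ≤ (8 * g1 * g2) * M ∧
        (2 * H * |(v p : ℝ)| ≤ |(u p : ℝ)| → (u p : ℝ) ^ 2 ≤ (8 * g1 * g2) * M) := by
      intro p hp
      obtain ⟨hpF, k1, k2⟩ := hmem p hp
      obtain ⟨huv, hv, hg0, hgm, hx, hy, hz⟩ := hpar p hpF
      have hdvd := conic_content_dvd hab huv hgm hx hy hz
      rw [k1, k2] at hdvd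
      have hgG : |(g p : ℝ)| ≤ 8 * g1 * g2 := by
        have := Int.le_of_dvd (by positivity) ((abs_dvd _ _).2 hdvd)
        exact_mod_cast this
      obtain ⟨p1, p2, p3⟩ := hPpos p (hFP p hpF)
      obtain ⟨m1, m2⟩ := hPM p (hFP p hpF)
      exact conic_param_bounds haR hbR haH hbH hHC p1 p2 m1 m2 p3 (hPeq p (hFP p hpF)) hgG
        (by exact_mod_cast hx) (by exact_mod_cast hy) (by exact_mod_cast hz)
    refine card_fibre_le _ u v haR haH hAR hAH hM hG
      (fun p hp => (hpar p (hmem p hp).1).2.1) (fun p hp => (hbd p hp).1)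
      (fun p hp => (hbd p hp).2.1) (fun p hp => (hbd p hp).2.2) ?_
    intro p hp q hq hpq
    obtain ⟨hpF, k1, k2⟩ := hmem p hp
    obtain ⟨hqF, l1, l2⟩ := hmem q hq
    have hdet0 : u p * v q - u q * v p ≠ 0 := by
      intro h0
      obtain ⟨-, hvp, hgp, -, hxp, hyp, -⟩ := hpar p hpF
      obtain ⟨-, hvq, hgq, -, hxq, hyq, -⟩ := hpar q hqF
      obtain ⟨p1, -, p3, p4, p5, -⟩ := hFP p hpF
      obtain ⟨q1, -, q3, q4, q5, -⟩ := hFP q hqF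
      have ex : g p * v q ^ 2 * p.1 = g q * v p ^ 2 * q.1 := by
        linear_combination v q ^ 2 * hxp - v p ^ 2 * hxq + 2 * (u p * v q + u q * v p) * h0
      have ey : g p * v q ^ 2 * p.2.1 = g q * v p ^ 2 * q.2.1 := by
        linear_combination v q ^ 2 * hyp - v p ^ 2 * hyq + 2 * (u p * v q + u q * v p) * h0 -
          4 * a * v p * v q * h0
      have hne0 : g p * v q ^ 2 * (g q * v p ^ 2) ≠ 0 :=
        mul_ne_zero (mul_ne_zero hgp (pow_ne_zero 2 hvq)) (mul_ne_zero hgq (pow_ne_zero 2 hvp))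
      obtain ⟨e1, e2⟩ := eq_of_coprime_of_mul_eq p1 q1 (Int.isCoprime_iff_gcd_eq_one.2 p5)
        (Int.isCoprime_iff_gcd_eq_one.2 q5) (mul_left_cancel₀ hne0 (by
          linear_combination g q * v p ^ 2 * q.2.1 * ex - g q * v p ^ 2 * q.1 * ey))
      rw [e1, e2, q4] at p4
      have e3 : p.2.2 = q.2.2 := by
        rcases sq_eq_sq_iff_eq_or_eq_neg.1 (mul_left_cancel₀ two_ne_zero p4) with h | h <;> linarith
      exact hpq (Prod.ext e1 (Prod.ext e2 e3))
    have d1 : (g1 : ℤ) ∣ u p * v q - u q * v p := by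
      have e1 : (g1 : ℤ) ∣ u p := k1 ▸ Int.gcd_dvd_left _ _
      have e2 : (g1 : ℤ) ∣ u q := l1 ▸ Int.gcd_dvd_left _ _
      exact dvd_sub (e1.mul_right _) (e2.mul_right _)
    have d2 : (g2 : ℤ) ∣ u p * v q - u q * v p := by
      have e1 : (g2 : ℤ) ∣ u p - a * v p := k2 ▸ Int.gcd_dvd_left _ _
      have e2 : (g2 : ℤ) ∣ u q - a * v q := l2 ▸ Int.gcd_dvd_left _ _
      have : u p * v q - u q * v p = (u p - a * v p) * v q - (u q - a * v q) * v p := by ring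
      rw [this]
      exact dvd_sub (e1.mul_right _) (e2.mul_right _)
    have hle := Int.le_of_dvd (by positivity) ((dvd_abs _ _).2 (mul_dvd_mul_of_gcd_dvd d1 d2 hg12))
    have hle' : (g1 : ℝ) * g2 ≤ |2 * ((u p : ℝ) * v q - u q * v p)| := by exact_mod_cast hle
    rw [abs_mul, abs_two] at hle'
    linarith
  have hFcard : (F.card : ℝ) ≤ numDivisors (a ^ 2 + b ^ 2) * numDivisors (a ^ 2 - b ^ 2) *
      (3 + 176 * (M / √|(a : ℝ) ^ 2 - b ^ 2|)) := by
    rw [Finset.card_eq_sum_card_fiberwise hcls]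
    push_cast
    refine (Finset.sum_le_sum hfib).trans ?_
    rw [Finset.sum_const, nsmul_eq_mul, hI, Finset.card_product]
    simp [numDivisors]
  have hone : (1 : ℝ) ≤ numDivisors (a ^ 2 + b ^ 2) * numDivisors (a ^ 2 - b ^ 2) := by
    have := Nat.mul_le_mul (one_le_numDivisors hC0) (one_le_numDivisors hA0)
    exact_mod_cast this
  rw [← div_div, ← hMdef]
  linarith

theorem card_divisors_le_two_mul_s4 (n : ℕ) :
    n.divisors.card ≤ 2 * (n.divisors.filter (fun d => d ^ 2 ≤ n)).card := by
  have hsplit := Finset.card_filter_add_card_filter_not (s := n.divisors) (fun d => d ^ 2 ≤ n)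
  have hle : (n.divisors.filter (fun d => ¬ d ^ 2 ≤ n)).card ≤
      (n.divisors.filter (fun d => d ^ 2 ≤ n)).card := by
    apply Finset.card_le_card_of_injOn (fun d => n / d)
    · intro d hd
      simp only [Finset.coe_filter, Set.mem_ofPred_eq, Nat.mem_divisors, not_le] at hd ⊢
      obtain ⟨⟨⟨e, rfl⟩, hn⟩, hlt⟩ := hd
      have hd0 : 0 < d := Nat.pos_of_ne_zero (left_ne_zero_of_mul hn)
      rw [Nat.mul_div_cancel_left _ hd0]
      refine ⟨⟨Dvd.intro_left d rfl, hn⟩, ?_⟩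
      have : e < d := by
        rw [sq] at hlt
        exact Nat.lt_of_mul_lt_mul_left hlt
      nlinarith
    · intro d hd e he hde
      simp only [Finset.coe_filter, Set.mem_ofPred_eq, Nat.mem_divisors, not_le] at hd he
      simp only at hde
      rw [← Nat.div_div_self hd.1.1 hd.1.2, hde, Nat.div_div_self he.1.1 he.1.2]
  omega

/-- The divisors of `a ^ 2 + b ^ 2` come from Gaussian integers dividing `a + b i`. -/
theorem exists_gaussian_divisor {a b d : ℤ} (hab : IsCoprime a b)
    (hd : d ∣ a ^ 2 + b ^ 2) :
    ∃ p q : ℤ, p ^ 2 + q ^ 2 ∣ a * p + b * q ∧ p ^ 2 + q ^ 2 ∣ b * p - a * q ∧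
      d ∣ p ^ 2 + q ^ 2 ∧ p ^ 2 + q ^ 2 ∣ 2 * d := by
  let z : GaussianInt := ⟨a, b⟩
  let w : GaussianInt := (d : ℤ)
  have hbez := EuclideanDomain.gcd_eq_gcd_ab z w
  obtain ⟨σ, hσ⟩ := EuclideanDomain.gcd_dvd_left z w
  obtain ⟨τ, hτ⟩ := EuclideanDomain.gcd_dvd_right z w
  generalize EuclideanDomain.gcd z w = g at *
  have hstar : star w = w := by
    ext <;> simp [w]
  have hzz : z * star z = ((a ^ 2 + b ^ 2 : ℤ) : GaussianInt) := by
    rw [← Zsqrtd.norm_eq_mul_conj]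
    congr 1
    simp only [Zsqrtd.norm_def, z]
    ring
  have hgg : ((g.re ^ 2 + g.im ^ 2 : ℤ) : GaussianInt) = g * star g := by
    rw [← Zsqrtd.norm_eq_mul_conj]
    congr 1
    simp only [Zsqrtd.norm_def]
    ring
  refine ⟨g.re, g.im, ?_, ?_, ?_, ?_⟩
  · have h1 := congrArg Zsqrtd.re hσ
    have h2 := congrArg Zsqrtd.im hσ
    simp only [Zsqrtd.re_mul, Zsqrtd.im_mul, z] at h1 h2
    exact ⟨σ.re, by rw [h1, h2]; ring⟩
  · have h1 := congrArg Zsqrtd.re hσ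
    have h2 := congrArg Zsqrtd.im hσ
    simp only [Zsqrtd.re_mul, Zsqrtd.im_mul, z] at h1 h2
    exact ⟨σ.im, by rw [h1, h2]; ring⟩
  · rw [← Zsqrtd.intCast_dvd_intCast (d := -1), hgg]
    obtain ⟨e, he⟩ := hd
    rw [he] at hzz
    push_cast at hzz
    rw [hbez, star_add, star_mul', star_mul', hstar]
    refine ⟨(e : GaussianInt) * EuclideanDomain.gcdA z w * star (EuclideanDomain.gcdA z w) +
      z * EuclideanDomain.gcdA z w * star (EuclideanDomain.gcdB z w) +
      EuclideanDomain.gcdB z w * (star z * star (EuclideanDomain.gcdA z w) +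
        w * star (EuclideanDomain.gcdB z w)), ?_⟩
    simp only [w] at *
    linear_combination (EuclideanDomain.gcdA z (d : GaussianInt) *
      star (EuclideanDomain.gcdA z (d : GaussianInt))) * hzz
  · rw [← Zsqrtd.intCast_dvd_intCast (d := -1), hgg]
    obtain ⟨r, s, hrs⟩ := hab
    have h2 : (2 : GaussianInt) = (⟨r, -s⟩ : GaussianInt) * z +
        (⟨r, s⟩ : GaussianInt) * star z := by
      ext
      · simp [z, Zsqrtd.re_mul]; linarith
      · simp [z, Zsqrtd.im_mul]; ring
    have hτ' : w = star g * star τ := by rw [← hstar, hτ, star_mul']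
    have hσ' : star z = star g * star σ := by rw [hσ, star_mul']
    push_cast
    refine ⟨(⟨r, -s⟩ : GaussianInt) * σ * star τ + (⟨r, s⟩ : GaussianInt) * star σ * τ, ?_⟩
    change 2 * w = _
    calc 2 * w = (⟨r, -s⟩ : GaussianInt) * z * w + (⟨r, s⟩ : GaussianInt) * star z * w := by
          rw [h2]; ring
      _ = (⟨r, -s⟩ : GaussianInt) * (g * σ) * (star g * star τ) +
          (⟨r, s⟩ : GaussianInt) * (star g * star σ) * (g * τ) := by
          rw [← hσ, ← hσ', ← hτ', ← hτ]
      _ = _ := by ring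

theorem exists_normalized_gaussian_divisor {a b d : ℤ} (hab : IsCoprime a b) (hd0 : d ≠ 0)
    (hd : d ∣ a ^ 2 + b ^ 2) :
    ∃ p : ℕ, ∃ q : ℤ, 0 < p ∧ -(p : ℤ) ≤ q ∧ q ≤ p ∧ (p : ℤ) ^ 2 + q ^ 2 ∣ a * p + b * q ∧
      (p : ℤ) ^ 2 + q ^ 2 ∣ b * p - a * q ∧ d ∣ (p : ℤ) ^ 2 + q ^ 2 ∧
      (p : ℤ) ^ 2 + q ^ 2 ∣ 2 * d := by
  obtain ⟨p, q, h1, h2, h3, h4⟩ := exists_gaussian_divisor hab hd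
  have hN : p ^ 2 + q ^ 2 ≠ 0 := by
    intro h
    rw [h, zero_dvd_iff] at h4
    exact hd0 (by linarith)
  have conv : ∀ P Q : ℤ, 0 < P → -P ≤ Q → Q ≤ P → P ^ 2 + Q ^ 2 = p ^ 2 + q ^ 2 →
      p ^ 2 + q ^ 2 ∣ a * P + b * Q → p ^ 2 + q ^ 2 ∣ b * P - a * Q →
      ∃ p : ℕ, ∃ q : ℤ, 0 < p ∧ -(p : ℤ) ≤ q ∧ q ≤ p ∧ (p : ℤ) ^ 2 + q ^ 2 ∣ a * p + b * q ∧
      (p : ℤ) ^ 2 + q ^ 2 ∣ b * p - a * q ∧ d ∣ (p : ℤ) ^ 2 + q ^ 2 ∧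
      (p : ℤ) ^ 2 + q ^ 2 ∣ 2 * d := by
    intro P Q hP l1 l2 e k1 k2
    lift P to ℕ using hP.le
    refine ⟨P, Q, by exact_mod_cast hP, l1, l2, ?_⟩
    rw [e]
    exact ⟨k1, k2, h3, h4⟩
  obtain ⟨k, hk⟩ := h1
  obtain ⟨l, hl⟩ := h2
  rcases le_or_gt |q| |p| with hqp | hqp
  · rcases lt_trichotomy p 0 with hp | hp | hp
    · rw [abs_of_neg hp, abs_le] at hqp
      refine conv (-p) (-q) (by linarith) (by linarith) (by linarith) (by ring) ?_ ?_
      · exact ⟨-k, by linear_combination -hk⟩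
      · exact ⟨-l, by linear_combination -hl⟩
    · subst hp
      simp at hqp
      simp [hqp] at hN
    · rw [abs_of_pos hp, abs_le] at hqp
      exact conv p q hp hqp.1 hqp.2 rfl ⟨k, hk⟩ ⟨l, hl⟩
  · rcases lt_or_ge q 0 with hq | hq
    · rw [abs_of_neg hq, abs_lt] at hqp
      refine conv (-q) p (by linarith) (by linarith) (by linarith) (by ring) ?_ ?_
      · exact ⟨l, by linear_combination hl⟩
      · exact ⟨-k, by linear_combination -hk⟩
    · rw [abs_of_nonneg hq, abs_lt] at hqp
      refine conv q (-p) (by linarith [hqp.1, hqp.2]) (by linarith) (by linarith) (by ring) ?_ ?_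
      · exact ⟨-l, by linear_combination -hl⟩
      · exact ⟨k, by linear_combination hk⟩

/-- Representatives of the nonzero Gaussian integers `p + q i`, `p ≤ m`, up to units. -/
noncomputable def gaussianSector (m : ℕ) : Finset (Σ _ : ℕ, ℤ) :=
  (Finset.Icc 1 m).sigma fun p => Finset.Icc (-(p : ℤ)) p

/-- The norm of the Gaussian integer `p + q i`. -/
def sectorNorm (w : Σ _ : ℕ, ℤ) : ℤ := (w.1 : ℤ) ^ 2 + w.2 ^ 2

/-- The Gaussian integer encoded by `w` divides `a + b i`. -/
def SectorDvd (w : Σ _ : ℕ, ℤ) (s : ℤ × ℤ) : Prop :=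
  sectorNorm w ∣ s.1 * w.1 + s.2 * w.2 ∧ sectorNorm w ∣ s.2 * w.1 - s.1 * w.2

theorem sectorNorm_pos {m : ℕ} {w : Σ _ : ℕ, ℤ} (hw : w ∈ gaussianSector m) :
    0 < sectorNorm w := by
  have h := (Finset.mem_Icc.1 (Finset.mem_sigma.1 hw).1).1
  have : (0 : ℤ) < w.1 := by exact_mod_cast h
  unfold sectorNorm
  positivity

theorem numDivisors_le_card_filter {n : ℤ} {m : ℕ} (hm : n.natAbs < (m + 1) ^ 2) :
    numDivisors n ≤ 2 * ((Finset.Icc 1 m).filter (fun d : ℕ => (d : ℤ) ∣ n)).card := by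
  refine (card_divisors_le_two_mul_s4 _).trans (Nat.mul_le_mul_left 2 (Finset.card_le_card ?_))
  intro d hd
  simp only [Finset.mem_filter, Nat.mem_divisors, Finset.mem_Icc] at hd ⊢
  obtain ⟨⟨h1, h2⟩, h3⟩ := hd
  refine ⟨⟨Nat.pos_of_dvd_of_pos h1 (Nat.pos_of_ne_zero h2), ?_⟩, Int.natCast_dvd.2 h1⟩
  exact Nat.lt_succ_iff.1 (lt_of_pow_lt_pow_left₀ 2 (Nat.zero_le _) (h3.trans_lt hm))

theorem numDivisors_le_card_sector {s : ℤ × ℤ} (hs : IsCoprime s.1 s.2) {m : ℕ}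
    (hm : 4 * (s.1 ^ 2 + s.2 ^ 2) < ((m : ℤ) + 1) ^ 4) :
    numDivisors (s.1 ^ 2 + s.2 ^ 2) ≤
      4 * ((gaussianSector m).filter (fun w => SectorDvd w s)).card := by
  obtain ⟨a, b⟩ := s
  simp only at hs hm ⊢
  set n := (a ^ 2 + b ^ 2).natAbs with hn
  have hnZ : (n : ℤ) = a ^ 2 + b ^ 2 := Int.natAbs_of_nonneg (by positivity)
  set T := n.divisors.filter (fun d => d ^ 2 ≤ n) with hT
  have hex : ∀ d : ℕ, ∃ w : Σ _ : ℕ, ℤ, d ∈ T →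
      w ∈ (gaussianSector m).filter (fun w => SectorDvd w (a, b)) ∧
      (sectorNorm w = d ∨ sectorNorm w = 2 * d) := by
    intro d
    by_cases hd : d ∈ T
    · simp only [hT, Finset.mem_filter, Nat.mem_divisors] at hd
      obtain ⟨⟨h1, h2⟩, h3⟩ := hd
      have hd0 : 0 < d := Nat.pos_of_dvd_of_pos h1 (Nat.pos_of_ne_zero h2)
      obtain ⟨p, q, hp, l1, l2, k1, k2, k3, k4⟩ := exists_normalized_gaussian_divisor hs
        (d := d) (by exact_mod_cast hd0.ne') (by rw [← hnZ]; exact_mod_cast h1)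
      refine ⟨⟨p, q⟩, fun _ => ⟨Finset.mem_filter.2 ⟨Finset.mem_sigma.2
        ⟨Finset.mem_Icc.2 ⟨hp, ?_⟩, Finset.mem_Icc.2 ⟨l1, l2⟩⟩, k1, k2⟩, ?_⟩⟩
      · have hpN : (p : ℤ) ^ 2 ≤ 2 * d :=
          (le_add_of_nonneg_right (sq_nonneg q)).trans (Int.le_of_dvd (by positivity) k4)
        have h3' : (d : ℤ) ^ 2 ≤ a ^ 2 + b ^ 2 := by rw [← hnZ]; exact_mod_cast h3
        have h4 : (p : ℤ) ^ 4 < ((m : ℤ) + 1) ^ 4 := by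
          calc (p : ℤ) ^ 4 = ((p : ℤ) ^ 2) ^ 2 := by ring
            _ ≤ (2 * (d : ℤ)) ^ 2 := by gcongr
            _ = 4 * (d : ℤ) ^ 2 := by ring
            _ ≤ 4 * (a ^ 2 + b ^ 2) := by gcongr
            _ < _ := hm
        have h5 := lt_of_pow_lt_pow_left₀ 4 (by positivity) h4
        exact Nat.lt_succ_iff.1 (by exact_mod_cast h5)
      · obtain ⟨k, hk⟩ := k3
        have hdZ : (0 : ℤ) < d := by exact_mod_cast hd0
        have hpZ : (0 : ℤ) < p := by exact_mod_cast hp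
        have hNpos : (0 : ℤ) < (p : ℤ) ^ 2 + q ^ 2 := by positivity
        have hle := Int.le_of_dvd (by positivity) k4
        have hk0 : 0 < k := by
          by_contra h
          nlinarith [not_lt.1 h]
        have hk2 : k ≤ 2 := by
          by_contra h
          nlinarith [not_le.1 h]
        simp only [sectorNorm]
        rw [hk]
        interval_cases k
        · left; ring
        · right; ring
    · exact ⟨⟨0, 0⟩, fun h => absurd h hd⟩
  choose w hw using hex
  have hcard : T.card ≤ (((gaussianSector m).filter (fun w => SectorDvd w (a, b))) ×ˢ
      (Finset.univ : Finset Bool)).card := by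
    apply Finset.card_le_card_of_injOn (fun d => (w d, decide (sectorNorm (w d) = d)))
    · intro d hd
      simp only [Finset.coe_product, Set.mem_prod, Finset.mem_coe, Finset.mem_univ, and_true]
      exact (hw d hd).1
    · intro d hd e he hde
      simp only [Prod.mk.injEq, decide_eq_decide] at hde
      have h1 := (hw d hd).2
      have h2 := (hw e he).2
      have h3 := hde.2
      rw [← hde.1] at h2 h3
      omega
  have h := card_divisors_le_two_mul_s4 n
  rw [← hT] at h
  rw [Finset.card_product, Finset.card_univ, Fintype.card_bool] at hcard
  unfold numDivisors
  rw [← hn]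
  omega

theorem sectorNorm_dvd_det {w : Σ _ : ℕ, ℤ} {s t : ℤ × ℤ} (hw : sectorNorm w ≠ 0)
    (hs : SectorDvd w s) (ht : SectorDvd w t) : sectorNorm w ∣ s.1 * t.2 - t.1 * s.2 := by
  obtain ⟨⟨r, hr⟩, ⟨k, hk⟩⟩ := hs
  obtain ⟨⟨r', hr'⟩, ⟨k', hk'⟩⟩ := ht
  refine ⟨r * k' - r' * k, ?_⟩
  apply mul_left_cancel₀ hw
  have : sectorNorm w * (sectorNorm w * (r * k' - r' * k)) =
      (sectorNorm w * r) * (sectorNorm w * k') - (sectorNorm w * r') * (sectorNorm w * k) := by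
    ring
  rw [this, ← hr, ← hk, ← hr', ← hk', sectorNorm]
  ring

theorem sectorNorm_dvd {w : Σ _ : ℕ, ℤ} {s : ℤ × ℤ} (hw : sectorNorm w ≠ 0)
    (hs : SectorDvd w s) : sectorNorm w ∣ s.1 ^ 2 + s.2 ^ 2 := by
  obtain ⟨⟨r, hr⟩, ⟨k, hk⟩⟩ := hs
  refine ⟨r ^ 2 + k ^ 2, ?_⟩
  apply mul_left_cancel₀ hw
  have : sectorNorm w * (sectorNorm w * (r ^ 2 + k ^ 2)) =
      (sectorNorm w * r) ^ 2 + (sectorNorm w * k) ^ 2 := by ring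
  rw [this, ← hr, ← hk, sectorNorm]
  ring

theorem card_pairs_le (S : Finset (ℤ × ℤ)) {X K : ℝ} (hX : 0 < X) (hK : 0 < K) {d₁ d₂ : ℤ}
    (hd₁ : 0 < d₁) (hd₂ : 0 < d₂) {w : Σ _ : ℕ, ℤ} (hw : 0 < sectorNorm w)
    (hpos : ∀ s ∈ S, 0 < s.2 ∧ s.2 < s.1) (hcop : ∀ s ∈ S, IsCoprime s.1 s.2)
    (hXs : ∀ s ∈ S, X / 2 < s.1 ∧ s.1 ≤ X) (hKs : ∀ s ∈ S, (s.1 : ℝ) - s.2 ≤ K)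
    (h₁ : ∀ s ∈ S, d₁ ∣ s.1 - s.2) (h₂ : ∀ s ∈ S, d₂ ∣ s.1 + s.2)
    (h₃ : ∀ s ∈ S, SectorDvd w s) :
    (S.card : ℝ) ≤ 1 + 16 * K * X * (1 / (d₁ : ℝ) * (1 / (d₂ : ℝ) * (1 / (sectorNorm w : ℝ)))) := by
  have hd₁' : (0 : ℝ) < d₁ := by exact_mod_cast hd₁
  have hd₂' : (0 : ℝ) < d₂ := by exact_mod_cast hd₂
  have hw' : (0 : ℝ) < sectorNorm w := by exact_mod_cast hw
  have hpos' : ∀ s ∈ S, (0 : ℝ) < s.2 ∧ (s.2 : ℝ) < s.1 := fun s hs =>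
    ⟨by exact_mod_cast (hpos s hs).1, by exact_mod_cast (hpos s hs).2⟩
  have key := card_le_of_det S (fun s => s.1 - s.2) (fun s => s.1) (l := 0) (len := 2 * K / X)
    (W := X ^ 2) (D := d₁ * d₂ * sectorNorm w / 8) (by positivity) (by positivity) (by positivity)
    (fun s hs => by have := hpos s hs; linarith) ?_ ?_ ?_
  · refine key.trans (le_of_eq ?_)
    field_simp
    ring
  · intro s hs
    have := hpos' s hs
    exact pow_le_pow_left₀ (by linarith) (hXs s hs).2 2
  · intro s hs
    have h0 := hpos' s hs
    have hs1 : (0 : ℝ) < s.1 := by linarith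
    push_cast
    refine ⟨div_nonneg (by linarith) hs1.le, ?_⟩
    rw [zero_add, div_le_div_iff₀ hs1 hX]
    have := (hXs s hs).1
    have := hKs s hs
    nlinarith
  · intro s hs t ht hst
    have hn0 : (s.1 - s.2) * t.1 - (t.1 - t.2) * s.1 ≠ 0 := by
      intro h
      have ps := hpos s hs
      have pt := hpos t ht
      obtain ⟨e1, e2⟩ := eq_of_coprime_of_mul_eq (by linarith) (by linarith) (hcop s hs) (hcop t ht)
        (by linear_combination h)
      exact hst (Prod.ext e1 e2)
    set n := (s.1 - s.2) * t.1 - (t.1 - t.2) * s.1 with hn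
    have dd1 : d₁ ∣ n := dvd_sub ((h₁ s hs).mul_right _) ((h₁ t ht).mul_right _)
    have dd2 : d₂ ∣ n := by
      have : n = (t.1 + t.2) * s.1 - (s.1 + s.2) * t.1 := by rw [hn]; ring
      rw [this]
      exact dvd_sub ((h₂ t ht).mul_right _) ((h₂ s hs).mul_right _)
    have dd3 : sectorNorm w ∣ n := by
      have : n = s.1 * t.2 - t.1 * s.2 := by rw [hn]; ring
      rw [this]
      exact sectorNorm_dvd_det hw.ne' (h₃ s hs) (h₃ t ht)
    obtain ⟨r, k, hrk⟩ := hcop s hs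
    obtain ⟨r2, k2, hrk2⟩ := (IsCoprime.pow (hcop s hs) : IsCoprime (s.1 ^ 2) (s.2 ^ 2))
    have g12 : ((Int.gcd d₁ d₂ : ℕ) : ℤ) ∣ 2 := by
      have k1 := (Int.gcd_dvd_left d₁ d₂).trans (h₁ s hs)
      have k2 := (Int.gcd_dvd_right d₁ d₂).trans (h₂ s hs)
      have : (2 : ℤ) = (r - k) * (s.1 - s.2) + (r + k) * (s.1 + s.2) := by
        linear_combination -2 * hrk
      rw [this]
      exact dvd_add (k1.mul_left _) (k2.mul_left _)
    have g123 : ((Int.gcd (d₁ * d₂) (sectorNorm w) : ℕ) : ℤ) ∣ 4 := by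
      have k1 := (Int.gcd_dvd_left (d₁ * d₂) (sectorNorm w)).trans
        (mul_dvd_mul (h₁ s hs) (h₂ s hs))
      have k2' := (Int.gcd_dvd_right (d₁ * d₂) (sectorNorm w)).trans
        (sectorNorm_dvd hw.ne' (h₃ s hs))
      have : (4 : ℤ) = 2 * (r2 - k2) * ((s.1 - s.2) * (s.1 + s.2)) +
          2 * (r2 + k2) * (s.1 ^ 2 + s.2 ^ 2) := by
        linear_combination -4 * hrk2
      rw [this]
      exact dvd_add (k1.mul_left _) (k2'.mul_left _)
    have hdvd := mul_dvd_mul_of_gcd_dvd (mul_dvd_mul_of_gcd_dvd dd1 dd2 g12) (dd3.mul_left 2) g123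
    have hle := Int.le_of_dvd (abs_pos.2 (by positivity)) ((dvd_abs _ _).2 hdvd)
    rw [abs_mul, abs_mul] at hle
    have hle' : (d₁ : ℝ) * d₂ * sectorNorm w ≤ 4 * (2 * |(n : ℝ)|) := by exact_mod_cast hle
    have e : (n : ℝ) = ((s.1 - s.2 : ℤ) : ℝ) * t.1 - ((t.1 - t.2 : ℤ) : ℝ) * s.1 := by
      rw [hn]; push_cast; ring
    rw [← e]
    linarith

theorem sum_one_div_Icc_le (n : ℕ) : ∑ d ∈ Finset.Icc 1 n, 1 / (d : ℝ) ≤ 1 + Real.log n := by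
  have := harmonic_le_one_add_log n
  rw [harmonic_eq_sum_Icc] at this
  push_cast at this
  simpa [one_div] using this

theorem card_gaussianSector_le (m : ℕ) : ((gaussianSector m).card : ℝ) ≤ 3 * (m : ℝ) ^ 2 := by
  have : (gaussianSector m).card ≤ m * (3 * m) := by
    rw [gaussianSector, Finset.card_sigma]
    refine (Finset.sum_le_card_nsmul _ _ (3 * m) fun p hp => ?_).trans (by simp)
    have := Finset.mem_Icc.1 hp
    rw [Int.card_Icc]
    omega
  calc ((gaussianSector m).card : ℝ) ≤ ((m * (3 * m) : ℕ) : ℝ) := by exact_mod_cast this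
    _ = _ := by push_cast; ring

theorem sum_one_div_sectorNorm_le (m : ℕ) :
    ∑ w ∈ gaussianSector m, 1 / (sectorNorm w : ℝ) ≤ 3 * (1 + Real.log m) := by
  rw [gaussianSector, Finset.sum_sigma]
  calc _ ≤ ∑ p ∈ Finset.Icc 1 m, 3 * (1 / (p : ℝ)) := by
        refine Finset.sum_le_sum fun p hp => ?_
        have hp1 := (Finset.mem_Icc.1 hp).1
        have hpR : (0 : ℝ) < p := by exact_mod_cast hp1
        refine (Finset.sum_le_card_nsmul _ _ (1 / (p : ℝ) ^ 2) fun q _ => ?_).trans ?_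
        · simp only [sectorNorm]
          push_cast
          gcongr
          linarith [sq_nonneg (q : ℝ)]
        · have hc : (Finset.Icc (-(p : ℤ)) p).card ≤ 3 * p := by rw [Int.card_Icc]; omega
          have hc' : ((Finset.Icc (-(p : ℤ)) p).card : ℝ) ≤ 3 * p := by exact_mod_cast hc
          rw [nsmul_eq_mul]
          calc _ ≤ 3 * (p : ℝ) * (1 / (p : ℝ) ^ 2) := by gcongr
            _ = 3 * (1 / (p : ℝ)) := by field_simp
    _ ≤ _ := by
        rw [← Finset.mul_sum]
        gcongr
        exact sum_one_div_Icc_le m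

theorem natFloor_sqrt_spec {x : ℝ} : x < ((⌊√x⌋₊ : ℝ) + 1) ^ 2 := by
  have := Nat.lt_floor_add_one √x
  rcases le_or_gt x 0 with h | h
  · have : (0 : ℝ) < (⌊√x⌋₊ : ℝ) + 1 := by positivity
    exact h.trans_lt (by positivity)
  · calc x = √x ^ 2 := (Real.sq_sqrt h.le).symm
      _ < _ := by gcongr

theorem one_add_log_natFloor_sqrt_le {x B : ℝ} (hB : 1 ≤ B) (hxB : x ≤ B ^ 2) :
    1 + Real.log (⌊√x⌋₊ : ℝ) ≤ 1 + Real.log B := by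
  rcases Nat.eq_zero_or_pos ⌊√x⌋₊ with h | h
  · rw [h]; simpa using Real.log_nonneg hB
  · have h' : (0 : ℝ) < (⌊√x⌋₊ : ℝ) := by exact_mod_cast h
    gcongr
    calc (⌊√x⌋₊ : ℝ) ≤ √x := Nat.floor_le (Real.sqrt_nonneg x)
      _ ≤ √(B ^ 2) := Real.sqrt_le_sqrt hxB
      _ = B := Real.sqrt_sq (by linarith)

/-- The sum of `τ(a² + b²) τ(a - b) τ(a + b)` over a dyadic region. -/
theorem sum_numDivisors_le (S : Finset (ℤ × ℤ)) {B K X : ℝ} (hB : 3 ≤ B) (hK : 1 ≤ K)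
    (hKX : K ≤ X) (hXB : X ^ 2 ≤ B) (hpos : ∀ s ∈ S, 0 < s.2 ∧ s.2 < s.1)
    (hcop : ∀ s ∈ S, IsCoprime s.1 s.2) (hXs : ∀ s ∈ S, X / 2 < s.1 ∧ s.1 ≤ X)
    (hKs : ∀ s ∈ S, (s.1 : ℝ) - s.2 ≤ K) :
    ∑ s ∈ S, (numDivisors (s.1 ^ 2 + s.2 ^ 2) : ℝ) *
        (numDivisors (s.1 - s.2) * numDivisors (s.1 + s.2)) ≤
      16 * (18 * (X * √X * √K) + 48 * (K * X * (1 + Real.log B) ^ 3)) := by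
  set n₁ := ⌊√K⌋₊ with hn₁
  set n₂ := ⌊√(2 * X)⌋₊ with hn₂
  set m := ⌊√(3 * X)⌋₊ with hm
  set I := Finset.Icc 1 n₁ ×ˢ Finset.Icc 1 n₂ ×ˢ gaussianSector m with hI
  set P : ℤ × ℤ → ℕ × ℕ × (Σ _ : ℕ, ℤ) → Prop := fun s i =>
    (i.1 : ℤ) ∣ s.1 - s.2 ∧ (i.2.1 : ℤ) ∣ s.1 + s.2 ∧ SectorDvd i.2.2 s with hP
  have hX1 : 1 ≤ X := hK.trans hKX
  have hXleB : X ≤ B := by nlinarith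
  have hX3 : 3 * X ≤ B ^ 2 := by nlinarith
  have point : ∀ s ∈ S, (numDivisors (s.1 ^ 2 + s.2 ^ 2) : ℝ) *
      (numDivisors (s.1 - s.2) * numDivisors (s.1 + s.2)) ≤ 16 * (I.filter (P s)).card := by
    intro s hs
    obtain ⟨p1, p2⟩ := hpos s hs
    obtain ⟨x1, x2⟩ := hXs s hs
    have x3 := hKs s hs
    have p1' : (0 : ℝ) < s.2 := by exact_mod_cast p1
    have p2' : (s.2 : ℝ) < s.1 := by exact_mod_cast p2
    have e1 : (s.1 - s.2).natAbs < (n₁ + 1) ^ 2 := by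
      have : ((s.1 - s.2).natAbs : ℤ) = s.1 - s.2 := Int.natAbs_of_nonneg (by linarith)
      have h : (s.1 - s.2 : ℝ) < ((n₁ : ℝ) + 1) ^ 2 := x3.trans_lt natFloor_sqrt_spec
      zify
      rw [abs_of_nonneg (by linarith)]
      exact_mod_cast h
    have e2 : (s.1 + s.2).natAbs < (n₂ + 1) ^ 2 := by
      have h : (s.1 + s.2 : ℝ) < ((n₂ : ℝ) + 1) ^ 2 :=
        lt_of_le_of_lt (by linarith) (natFloor_sqrt_spec (x := 2 * X))
      zify
      rw [abs_of_nonneg (by linarith)]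
      exact_mod_cast h
    have e3 : 4 * (s.1 ^ 2 + s.2 ^ 2) < ((m : ℤ) + 1) ^ 4 := by
      have h0 := natFloor_sqrt_spec (x := 3 * X)
      rw [← hm] at h0
      have h : 4 * ((s.1 : ℝ) ^ 2 + (s.2 : ℝ) ^ 2) < ((m : ℝ) + 1) ^ 4 := by
        calc 4 * ((s.1 : ℝ) ^ 2 + (s.2 : ℝ) ^ 2) ≤ 8 * X ^ 2 := by nlinarith
          _ < (3 * X) ^ 2 := by nlinarith
          _ < (((m : ℝ) + 1) ^ 2) ^ 2 := by gcongr
          _ = _ := by ring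
      exact_mod_cast h
    have f1 := numDivisors_le_card_filter e1
    have f2 := numDivisors_le_card_filter e2
    have f3 := numDivisors_le_card_sector (hcop s hs) e3
    have hc : I.filter (P s) = (Finset.Icc 1 n₁).filter (fun d : ℕ => (d : ℤ) ∣ s.1 - s.2) ×ˢ
        (Finset.Icc 1 n₂).filter (fun d : ℕ => (d : ℤ) ∣ s.1 + s.2) ×ˢ
        (gaussianSector m).filter (fun w => SectorDvd w s) := by
      ext i
      simp only [hI, hP, Finset.mem_filter, Finset.mem_product]
      tauto
    rw [hc, Finset.card_product, Finset.card_product]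
    have := Nat.mul_le_mul f3 (Nat.mul_le_mul f1 f2)
    rify at this
    push_cast
    linarith
  have swap : ∑ s ∈ S, ((I.filter (P s)).card : ℝ) =
      ∑ i ∈ I, ((S.filter (fun s => P s i)).card : ℝ) := by
    have := Finset.sum_card_bipartiteAbove_eq_sum_card_bipartiteBelow (s := S) (t := I) P
    exact_mod_cast this
  have cell : ∀ i ∈ I, ((S.filter (fun s => P s i)).card : ℝ) ≤
      1 + 16 * K * X * (1 / (i.1 : ℝ) * (1 / (i.2.1 : ℝ) * (1 / (sectorNorm i.2.2 : ℝ)))) := by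
    rintro ⟨d₁, d₂, w⟩ hi
    simp only [hI, Finset.mem_product, Finset.mem_Icc] at hi
    obtain ⟨h1, h2, h3⟩ := hi
    have := card_pairs_le (S.filter (fun s => P s (d₁, d₂, w))) (X := X) (K := K)
      (d₁ := d₁) (d₂ := d₂) (w := w) (by linarith) (by linarith) (by exact_mod_cast h1.1)
      (by exact_mod_cast h2.1) (sectorNorm_pos h3)
      (fun s hs => hpos s (Finset.mem_filter.1 hs).1)
      (fun s hs => hcop s (Finset.mem_filter.1 hs).1)
      (fun s hs => hXs s (Finset.mem_filter.1 hs).1)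
      (fun s hs => hKs s (Finset.mem_filter.1 hs).1)
      (fun s hs => (Finset.mem_filter.1 hs).2.1)
      (fun s hs => (Finset.mem_filter.1 hs).2.2.1)
      (fun s hs => (Finset.mem_filter.1 hs).2.2.2)
    simpa using this
  have cardI : (I.card : ℝ) ≤ 18 * (X * √X * √K) := by
    have c1 : (n₁ : ℝ) ≤ √K := Nat.floor_le (Real.sqrt_nonneg _)
    have c2 : (n₂ : ℝ) ≤ 2 * √X := by
      refine (Nat.floor_le (Real.sqrt_nonneg _)).trans ?_
      rw [Real.sqrt_le_left (by positivity), mul_pow, Real.sq_sqrt (by linarith)]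
      linarith
    have c3 : ((gaussianSector m).card : ℝ) ≤ 9 * X := by
      refine (card_gaussianSector_le m).trans ?_
      have : (m : ℝ) ≤ √(3 * X) := Nat.floor_le (Real.sqrt_nonneg _)
      have : (m : ℝ) ^ 2 ≤ √(3 * X) ^ 2 := by gcongr
      rw [Real.sq_sqrt (by linarith)] at this
      linarith
    rw [hI, Finset.card_product, Finset.card_product, Nat.card_Icc, Nat.card_Icc]
    push_cast [Nat.add_sub_cancel]
    calc (n₁ : ℝ) * (n₂ * (gaussianSector m).card) ≤ √K * (2 * √X * (9 * X)) := by gcongr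
      _ = _ := by ring
  have sumI : ∑ i ∈ I, 1 / (i.1 : ℝ) * (1 / (i.2.1 : ℝ) * (1 / (sectorNorm i.2.2 : ℝ))) ≤
      3 * (1 + Real.log B) ^ 3 := by
    have hL : 0 ≤ Real.log B := Real.log_nonneg (by linarith)
    have l1 := (sum_one_div_Icc_le n₁).trans
      (one_add_log_natFloor_sqrt_le (x := K) (B := B) (by linarith) (by linarith))
    have l2 := (sum_one_div_Icc_le n₂).trans
      (one_add_log_natFloor_sqrt_le (x := 2 * X) (B := B) (by linarith)
        (by linarith))
    have l3 : ∑ w ∈ gaussianSector m, 1 / (sectorNorm w : ℝ) ≤ 3 * (1 + Real.log B) := by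
      have := one_add_log_natFloor_sqrt_le (x := 3 * X) (B := B) (by linarith)
        (by linarith)
      exact (sum_one_div_sectorNorm_le m).trans (by linarith)
    have e : ∑ i ∈ I, 1 / (i.1 : ℝ) * (1 / (i.2.1 : ℝ) * (1 / (sectorNorm i.2.2 : ℝ))) =
        (∑ d ∈ Finset.Icc 1 n₁, 1 / (d : ℝ)) * ((∑ d ∈ Finset.Icc 1 n₂, 1 / (d : ℝ)) *
          ∑ w ∈ gaussianSector m, 1 / (sectorNorm w : ℝ)) := by
      rw [hI, Finset.sum_product, Finset.sum_mul_sum, ← Finset.sum_product', Finset.sum_mul_sum]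
      simp only [Finset.sum_product, Finset.mul_sum]
    rw [e]
    have w0 : 0 ≤ ∑ w ∈ gaussianSector m, 1 / (sectorNorm w : ℝ) :=
      Finset.sum_nonneg fun w hw => by
        have : (0 : ℝ) < sectorNorm w := by exact_mod_cast sectorNorm_pos hw
        positivity
    have d0 : ∀ n : ℕ, 0 ≤ ∑ d ∈ Finset.Icc 1 n, 1 / (d : ℝ) := fun n =>
      Finset.sum_nonneg fun d _ => by positivity
    calc _ ≤ (1 + Real.log B) * ((1 + Real.log B) * (3 * (1 + Real.log B))) := by
          have := d0 n₁
          have := d0 n₂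
          gcongr
      _ = _ := by ring
  calc _ ≤ ∑ s ∈ S, 16 * ((I.filter (P s)).card : ℝ) := Finset.sum_le_sum point
    _ = 16 * ∑ i ∈ I, ((S.filter (fun s => P s i)).card : ℝ) := by rw [← Finset.mul_sum, swap]
    _ ≤ 16 * ∑ i ∈ I, (1 + 16 * K * X *
          (1 / (i.1 : ℝ) * (1 / (i.2.1 : ℝ) * (1 / (sectorNorm i.2.2 : ℝ))))) := by
        gcongr with i hi
        exact cell i hi
    _ = 16 * (I.card + 16 * K * X * ∑ i ∈ I,
          1 / (i.1 : ℝ) * (1 / (i.2.1 : ℝ) * (1 / (sectorNorm i.2.2 : ℝ)))) := by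
        rw [Finset.sum_add_distrib, ← Finset.mul_sum]
        simp
    _ ≤ 16 * (18 * (X * √X * √K) + 16 * K * X * (3 * (1 + Real.log B) ^ 3)) := by gcongr
    _ = _ := by ring

theorem numDivisors_mul_le (m n : ℤ) :
    numDivisors (m * n) ≤ numDivisors m * numDivisors n := by
  rw [numDivisors, Int.natAbs_mul, Nat.divisors_mul]
  exact Finset.card_mul_le

theorem numDivisors_neg (n : ℤ) : numDivisors (-n) = numDivisors n := by
  rw [numDivisors, numDivisors, Int.natAbs_neg]

/-- The upper bound for `Mcount` coming from counting points on conics. -/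
noncomputable def conicBound (B : ℝ) (s : ℤ × ℤ) : ℝ :=
  numDivisors (s.1 ^ 2 + s.2 ^ 2) * numDivisors (s.1 ^ 2 - s.2 ^ 2) *
    (4 + 176 * (B / ((max s.1 s.2 : ℤ) * √|(s.1 : ℝ) ^ 2 - (s.2 : ℝ) ^ 2|)))

theorem conicBound_swap (B : ℝ) (s : ℤ × ℤ) : conicBound B s.swap = conicBound B s := by
  rw [conicBound, conicBound, Prod.fst_swap, Prod.snd_swap, add_comm (s.2 ^ 2), max_comm,
    abs_sub_comm, ← neg_sub (s.1 ^ 2), numDivisors_neg]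

theorem conicBound_nonneg {B : ℝ} (hB : 0 ≤ B) {s : ℤ × ℤ} (hs : 0 < s.1) :
    0 ≤ conicBound B s := by
  have : (0 : ℝ) < (max s.1 s.2 : ℤ) := by exact_mod_cast lt_max_of_lt_left hs
  unfold conicBound
  positivity

theorem sum_le_sum_of_cover {ι : Type*} (S : Finset ι) (f : ι → ℝ) (hf : ∀ s ∈ S, 0 ≤ f s)
    (n : ℕ) (P : ℕ → ι → Prop) [∀ i, DecidablePred (P i)] (hP : ∀ s ∈ S, ∃ i < n, P i s) :
    ∑ s ∈ S, f s ≤ ∑ i ∈ Finset.range n, ∑ s ∈ S.filter (P i), f s := by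
  simp_rw [Finset.sum_filter]
  rw [Finset.sum_comm]
  refine Finset.sum_le_sum fun s hs => ?_
  obtain ⟨i, hi, hPi⟩ := hP s hs
  have := Finset.single_le_sum (f := fun i => if P i s then f s else 0)
    (fun j _ => by split_ifs; exacts [hf s hs, le_rfl]) (Finset.mem_range.2 hi)
  simpa [hPi] using this

theorem conicBound_le {B K X : ℝ} (hB : 0 ≤ B) (hK : 0 < K) (hX : 0 < X) {s : ℤ × ℤ}
    (h0 : 0 < s.2) (hlt : s.2 < s.1) (hXs : X / 2 < s.1) (hKs : K / 4 < (s.1 : ℝ) - s.2) :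
    conicBound B s ≤ (4 + 1056 * (B / (X * √X * √K))) *
      (numDivisors (s.1 ^ 2 + s.2 ^ 2) *
        (numDivisors (s.1 - s.2) * numDivisors (s.1 + s.2))) := by
  have h0' : (0 : ℝ) < s.2 := by exact_mod_cast h0
  have hlt' : (s.2 : ℝ) < s.1 := by exact_mod_cast hlt
  have hpos : (0 : ℝ) < s.1 := h0'.trans hlt'
  have hd : (numDivisors (s.1 ^ 2 - s.2 ^ 2) : ℝ) ≤
      numDivisors (s.1 - s.2) * numDivisors (s.1 + s.2) := by
    rw [show s.1 ^ 2 - s.2 ^ 2 = (s.1 - s.2) * (s.1 + s.2) by ring]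
    exact_mod_cast numDivisors_mul_le _ _
  have hr : √X * √K / 3 ≤ √|(s.1 : ℝ) ^ 2 - (s.2 : ℝ) ^ 2| := by
    apply Real.le_sqrt_of_sq_le
    rw [div_pow, mul_pow, Real.sq_sqrt hX.le, Real.sq_sqrt hK.le, abs_of_nonneg (by nlinarith)]
    have : X / 2 * (K / 4) ≤ s.1 * ((s.1 : ℝ) - s.2) := by gcongr
    nlinarith
  have hw : B / ((max s.1 s.2 : ℤ) * √|(s.1 : ℝ) ^ 2 - (s.2 : ℝ) ^ 2|) ≤
      6 * (B / (X * √X * √K)) := by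
    rw [max_eq_left hlt.le]
    calc _ ≤ B / (X / 2 * (√X * √K / 3)) := by gcongr
      _ = _ := by field_simp; ring
  have := Real.sqrt_pos.2 hX
  have := Real.sqrt_pos.2 hK
  rw [conicBound]
  calc _ ≤ (numDivisors (s.1 ^ 2 + s.2 ^ 2) : ℝ) *
        (numDivisors (s.1 - s.2) * numDivisors (s.1 + s.2)) *
          (4 + 176 * (6 * (B / (X * √X * √K)))) := by gcongr
    _ = _ := by ring

theorem sum_conicBound_cell_le (S : Finset (ℤ × ℤ)) {B X : ℝ} (j : ℕ) (hB : 3 ≤ B)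
    (hX : 0 < X) (hXB : X ^ 2 ≤ B) (hpos : ∀ s ∈ S, 0 < s.2 ∧ s.2 < s.1)
    (hcop : ∀ s ∈ S, IsCoprime s.1 s.2) (hXs : ∀ s ∈ S, X / 2 < s.1 ∧ s.1 ≤ X)
    (hKs : ∀ s ∈ S, X / 4 ^ j / 4 < (s.1 : ℝ) - s.2 ∧ (s.1 : ℝ) - s.2 ≤ X / 4 ^ j) :
    ∑ s ∈ S, conicBound B s ≤
      304128 * B + 815232 * (B * (1 + Real.log B) ^ 3) * (1 / 2) ^ j := by
  have hL : 0 ≤ Real.log B := Real.log_nonneg (by linarith)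
  rcases S.eq_empty_or_nonempty with rfl | ⟨s, hs⟩
  · rw [Finset.sum_empty]
    positivity
  set K := X / 4 ^ j with hKdef
  have hK0 : 0 < K := by positivity
  have hK1 : 1 ≤ K := by
    have h1 : (1 : ℤ) ≤ s.1 - s.2 := by have := hpos s hs; omega
    have h2 : (1 : ℝ) ≤ s.1 - s.2 := by exact_mod_cast h1
    exact h2.trans (hKs s hs).2
  have hKX : K ≤ X := div_le_self hX.le (one_le_pow₀ (by norm_num))
  have key := sum_numDivisors_le S hB hK1 hKX hXB hpos hcop hXs fun s hs => (hKs s hs).2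
  set Λ := 1 + Real.log B with hΛ
  have hΛ1 : 1 ≤ Λ ^ 3 := one_le_pow₀ (by linarith)
  set t : ℝ := (1 / 2) ^ j with ht
  have ht0 : 0 < t := by positivity
  have ht1 : t ≤ 1 := pow_le_one₀ (by norm_num) (by norm_num)
  have hK : K = X * t ^ 2 := by
    rw [hKdef, ht, ← pow_mul, mul_comm j, pow_mul, div_eq_mul_inv, ← inv_pow]
    norm_num
  have hsK : √K = √X * t := by
    rw [hK, Real.sqrt_mul hX.le, Real.sqrt_sq ht0.le]
  have hU : X * √X * √K = X ^ 2 * t := by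
    rw [hsK, show X * √X * (√X * t) = X * (√X * √X) * t by ring, Real.mul_self_sqrt hX.le]
    ring
  calc _ ≤ ∑ s ∈ S, (4 + 1056 * (B / (X * √X * √K))) *
        ((numDivisors (s.1 ^ 2 + s.2 ^ 2) : ℝ) *
          (numDivisors (s.1 - s.2) * numDivisors (s.1 + s.2))) :=
        Finset.sum_le_sum fun s hs => conicBound_le (by linarith) hK0 hX (hpos s hs).1
          (hpos s hs).2 (hXs s hs).1 (hKs s hs).1
    _ ≤ (4 + 1056 * (B / (X * √X * √K))) *
        (16 * (18 * (X * √X * √K) + 48 * (K * X * Λ ^ 3))) := by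
        rw [← Finset.mul_sum]
        gcongr
    _ = 1152 * (X ^ 2 * t) + 3072 * (X ^ 2 * (t * t) * Λ ^ 3) + 304128 * B +
        811008 * (B * Λ ^ 3) * t := by
        rw [hU, hK]
        field_simp
        ring
    _ ≤ 1152 * (B * t * Λ ^ 3) + 3072 * (B * (t * 1) * Λ ^ 3) + 304128 * B +
        811008 * (B * Λ ^ 3) * t := by
        have : X ^ 2 * t ≤ B * t * Λ ^ 3 :=
          (mul_le_mul_of_nonneg_right hXB ht0.le).trans
            (le_mul_of_one_le_right (by positivity) hΛ1)
        gcongr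
    _ ≤ _ := le_of_eq (by ring)

theorem sum_conicBound_dyadic_le (S : Finset (ℤ × ℤ)) {B X : ℝ} (hB : 3 ≤ B)
    (hX : 0 < X) (hXB : X ^ 2 ≤ B) (hpos : ∀ s ∈ S, 0 < s.2 ∧ s.2 < s.1)
    (hcop : ∀ s ∈ S, IsCoprime s.1 s.2) (hXs : ∀ s ∈ S, X / 2 < s.1 ∧ s.1 ≤ X) :
    ∑ s ∈ S, conicBound B s ≤ 1934592 * (B * (1 + Real.log B) ^ 3) := by
  have hL : 0 ≤ Real.log B := Real.log_nonneg (by linarith)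
  set P : ℕ → ℤ × ℤ → Prop := fun j s =>
    X / 4 ^ j / 4 < (s.1 : ℝ) - s.2 ∧ (s.1 : ℝ) - s.2 ≤ X / 4 ^ j with hP
  have hcover : ∀ s ∈ S, ∃ j < ⌊Real.log B⌋₊ + 1, P j s := by
    intro s hs
    obtain ⟨p1, p2⟩ := hpos s hs
    have p1' : (0 : ℝ) < s.2 := by exact_mod_cast p1
    have h1 : (1 : ℝ) ≤ s.1 - s.2 := by
      have : (1 : ℤ) ≤ s.1 - s.2 := by omega
      exact_mod_cast this
    have hX2 := (hXs s hs).2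
    obtain ⟨j, hj1, hj2⟩ := exists_nat_pow_near (x := X / ((s.1 : ℝ) - s.2)) (y := 4)
      (by rw [le_div_iff₀ (by linarith)]; linarith) (by norm_num)
    rw [le_div_iff₀ (by linarith)] at hj1
    rw [div_lt_iff₀ (by linarith)] at hj2
    refine ⟨j, Nat.lt_succ_of_le (Nat.le_floor ?_), ?_, ?_⟩
    · have h4 : (4 : ℝ) ^ j ≤ B := by
        have : (4 : ℝ) ^ j ≤ 4 ^ j * (s.1 - s.2) := le_mul_of_one_le_right (by positivity) h1
        nlinarith
      have h5 := Real.log_le_log (by positivity) h4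
      rw [Real.log_pow] at h5
      have h6 : 1 ≤ Real.log 4 := by
        rw [Real.le_log_iff_exp_le (by norm_num)]
        linarith [Real.exp_one_lt_d9]
      have : (j : ℝ) ≤ j * Real.log 4 := le_mul_of_one_le_right (by positivity) h6
      linarith
    · rw [div_div, div_lt_iff₀ (by positivity)]
      rw [pow_succ] at hj2
      linarith
    · rw [le_div_iff₀ (by positivity)]
      linarith
  have hge : ∑ j ∈ Finset.range (⌊Real.log B⌋₊ + 1), (1 / 2 : ℝ) ^ j ≤ 2 :=
    sum_geometric_two_le _
  have hfl : ((⌊Real.log B⌋₊ + 1 : ℕ) : ℝ) ≤ 1 + Real.log B := by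
    push_cast
    linarith [Nat.floor_le hL]
  set Λ := 1 + Real.log B with hΛ
  have hΛ1 : Λ ≤ Λ ^ 3 := le_self_pow₀ (by linarith) (by norm_num)
  calc _ ≤ ∑ j ∈ Finset.range (⌊Real.log B⌋₊ + 1), ∑ s ∈ S.filter (P j), conicBound B s :=
        sum_le_sum_of_cover S (conicBound B) (fun s hs => conicBound_nonneg (by linarith)
          ((hpos s hs).1.trans (hpos s hs).2)) _ P hcover
    _ ≤ ∑ j ∈ Finset.range (⌊Real.log B⌋₊ + 1),
        (304128 * B + 815232 * (B * Λ ^ 3) * (1 / 2) ^ j) := by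
        refine Finset.sum_le_sum fun j _ => sum_conicBound_cell_le _ j hB hX hXB ?_ ?_ ?_ ?_
        · exact fun s hs => hpos s (Finset.mem_filter.1 hs).1
        · exact fun s hs => hcop s (Finset.mem_filter.1 hs).1
        · exact fun s hs => hXs s (Finset.mem_filter.1 hs).1
        · exact fun s hs => (Finset.mem_filter.1 hs).2
    _ = ((⌊Real.log B⌋₊ + 1 : ℕ) : ℝ) * (304128 * B) + 815232 * (B * Λ ^ 3) *
        ∑ j ∈ Finset.range (⌊Real.log B⌋₊ + 1), (1 / 2 : ℝ) ^ j := by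
        rw [Finset.sum_add_distrib, Finset.sum_const, Finset.card_range, nsmul_eq_mul,
          ← Finset.mul_sum]
    _ ≤ Λ ^ 3 * (304128 * B) + 815232 * (B * Λ ^ 3) * 2 := by
        have : 0 ≤ Λ := by linarith
        gcongr
        exact hfl.trans hΛ1
    _ = _ := by ring

theorem sum_conicBound_le (S : Finset (ℤ × ℤ)) {B T : ℝ} (hB : 3 ≤ B) (hT : 0 < T)
    (hpos : ∀ s ∈ S, 0 < s.2 ∧ s.2 < s.1) (hcop : ∀ s ∈ S, IsCoprime s.1 s.2)
    (hS : ∀ s ∈ S, √B / T < s.1 ∧ s.1 ≤ √B) :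
    ∑ s ∈ S, conicBound B s ≤ 64000000 * B * Real.log B ^ 3 * Real.log (T + 2) := by
  have hlog2 : 1 / 2 ≤ Real.log 2 := by linarith [Real.log_two_gt_d9]
  have hlT : Real.log 2 ≤ Real.log (T + 2) := Real.log_le_log (by norm_num) (by linarith)
  have hLB : 1 ≤ Real.log B := by
    rw [Real.le_log_iff_exp_le (by linarith)]
    linarith [Real.exp_one_lt_d9]
  have hr : 0 < √B := Real.sqrt_pos.2 (by linarith)
  set P : ℕ → ℤ × ℤ → Prop := fun i s => √B / 2 ^ i / 2 < s.1 ∧ s.1 ≤ √B / 2 ^ i with hP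
  set n := ⌊2 * Real.log (T + 2)⌋₊ + 1 with hn
  have hcover : ∀ s ∈ S, ∃ i < n, P i s := by
    intro s hs
    obtain ⟨p1, p2⟩ := hpos s hs
    have p0 : (0 : ℝ) < s.1 := by exact_mod_cast p1.trans p2
    obtain ⟨hs1, hs2⟩ := hS s hs
    obtain ⟨i, hi1, hi2⟩ := exists_nat_pow_near (x := √B / s.1) (y := 2)
      (by rwa [le_div_iff₀ p0, one_mul]) (by norm_num)
    rw [le_div_iff₀ p0] at hi1
    rw [div_lt_iff₀ p0] at hi2
    rw [div_lt_iff₀ hT] at hs1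
    refine ⟨i, Nat.lt_succ_of_le (Nat.le_floor ?_), ?_, ?_⟩
    · have h4 : (2 : ℝ) ^ i ≤ T + 2 := by
        have : (2 : ℝ) ^ i < T := by nlinarith
        linarith
      have h5 := Real.log_le_log (by positivity) h4
      rw [Real.log_pow] at h5
      have : (i : ℝ) * (1 / 2) ≤ i * Real.log 2 := by gcongr
      linarith
    · rw [div_div, div_lt_iff₀ (by positivity)]
      rw [pow_succ] at hi2
      linarith
    · rw [le_div_iff₀ (by positivity)]
      linarith
  calc _ ≤ ∑ i ∈ Finset.range n, ∑ s ∈ S.filter (P i), conicBound B s :=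
        sum_le_sum_of_cover S (conicBound B) (fun s hs => conicBound_nonneg (by linarith)
          ((hpos s hs).1.trans (hpos s hs).2)) _ P hcover
    _ ≤ ∑ i ∈ Finset.range n, 1934592 * (B * (1 + Real.log B) ^ 3) := by
        refine Finset.sum_le_sum fun i _ => sum_conicBound_dyadic_le _ (X := √B / 2 ^ i) hB
          (by positivity) ?_ ?_ ?_ ?_
        · calc _ ≤ √B ^ 2 := by
                gcongr
                exact div_le_self hr.le (one_le_pow₀ (by norm_num))
            _ = B := Real.sq_sqrt (by linarith)
        · exact fun s hs => hpos s (Finset.mem_filter.1 hs).1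
        · exact fun s hs => hcop s (Finset.mem_filter.1 hs).1
        · exact fun s hs => (Finset.mem_filter.1 hs).2
    _ = n * (1934592 * (B * (1 + Real.log B) ^ 3)) := by simp
    _ ≤ (4 * Real.log (T + 2)) * (2000000 * (B * (2 * Real.log B) ^ 3)) := by
        have : (n : ℝ) ≤ 4 * Real.log (T + 2) := by
          rw [hn]
          push_cast
          linarith [Nat.floor_le (show 0 ≤ 2 * Real.log (T + 2) by linarith)]
        gcongr <;> linarith
    _ = _ := by ring

theorem sum_Mcount_large_max_bound :
    ∃ C : ℝ, 0 < C ∧ ∀ B : ℝ, 3 ≤ B → ∀ T : ℝ, 0 < T →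
      ∑ q ∈ (Finset.Icc (1 : ℤ) ⌊Real.sqrt B⌋ ×ˢ
          Finset.Icc (1 : ℤ) ⌊Real.sqrt B⌋).filter
          (fun q => Int.gcd q.1 q.2 = 1 ∧ q.1 * q.2 ≠ 1 ∧
            Real.sqrt B / T < ((max q.1 q.2 : ℤ) : ℝ) ∧
            ((max q.1 q.2 : ℤ) : ℝ) ≤ Real.sqrt B),
        (Mcount q.1 q.2 B : ℝ) ≤ C * B * Real.log B ^ 3 * Real.log (T + 2) := by
  refine ⟨128000000, by norm_num, fun B hB T hT => ?_⟩
  set F := (Finset.Icc (1 : ℤ) ⌊Real.sqrt B⌋ ×ˢ Finset.Icc (1 : ℤ) ⌊Real.sqrt B⌋).filter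
    (fun q => Int.gcd q.1 q.2 = 1 ∧ q.1 * q.2 ≠ 1 ∧ Real.sqrt B / T < ((max q.1 q.2 : ℤ) : ℝ) ∧
      ((max q.1 q.2 : ℤ) : ℝ) ≤ Real.sqrt B) with hF
  have mem : ∀ q ∈ F, 0 < q.1 ∧ 0 < q.2 ∧ IsCoprime q.1 q.2 ∧ q.1 ≠ q.2 ∧
      √B / T < ((max q.1 q.2 : ℤ) : ℝ) ∧ ((max q.1 q.2 : ℤ) : ℝ) ≤ √B := by
    intro q hq
    simp only [hF, Finset.mem_filter, Finset.mem_product, Finset.mem_Icc] at hq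
    obtain ⟨⟨h1, h2⟩, h3, h4, h5, h6⟩ := hq
    refine ⟨by omega, by omega, Int.isCoprime_iff_gcd_eq_one.2 h3, fun h => h4 ?_, h5, h6⟩
    rw [← h, Int.gcd_self] at h3
    rw [← h, show q.1 = 1 by omega, one_mul]
  have gt_half : ∑ q ∈ F.filter (fun q => q.2 < q.1), conicBound B q ≤
      64000000 * B * Real.log B ^ 3 * Real.log (T + 2) := by
    refine sum_conicBound_le _ hB hT ?_ ?_ ?_ <;> intro q hq <;>
      obtain ⟨hq, hlt⟩ := Finset.mem_filter.1 hq <;> obtain ⟨-, h2, h3, -, h5⟩ := mem q hq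
    · exact ⟨h2, hlt⟩
    · exact h3
    · rwa [max_eq_left hlt.le] at h5
  have lt_half : ∑ q ∈ F.filter (fun q => ¬ q.2 < q.1), conicBound B q ≤
      64000000 * B * Real.log B ^ 3 * Real.log (T + 2) := by
    have := sum_conicBound_le ((F.filter (fun q => ¬ q.2 < q.1)).map
      (Equiv.prodComm ℤ ℤ).toEmbedding) hB hT ?_ ?_ ?_
    · rw [Finset.sum_map] at this
      simpa [conicBound_swap] using this
    all_goals
      intro q hq
      obtain ⟨q, hq', rfl⟩ := Finset.mem_map.1 hq
      obtain ⟨hq, hlt⟩ := Finset.mem_filter.1 hq'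
      obtain ⟨h1, -, h3, h4, h5⟩ := mem q hq
      have hlt' : q.1 < q.2 := by omega
    · exact ⟨h1, hlt'⟩
    · exact h3.symm
    · rw [max_eq_right hlt'.le] at h5
      exact h5
  calc _ ≤ ∑ q ∈ F, conicBound B q := Finset.sum_le_sum fun q hq => by
        obtain ⟨h1, h2, h3, h4, -⟩ := mem q hq
        exact Mcount_le h1 h2 h3 h4 (by linarith)
    _ = _ := (Finset.sum_filter_add_sum_filter_not F (fun q => q.2 < q.1) _).symm
    _ ≤ _ := add_le_add gt_half lt_half
    _ = _ := by ring
end
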